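/- Let p be a prime and let B be a quaternion algebra over ℚ ramified exactly at p and ∞, and let O and O' be maximal orders of B. The following statements are equivalent: (a) there exists a nonzero c ∈ B with c·O^T·c⁻¹ = O'^T; (b) r_{O^T}(n) = r_{O'^T}(n) for every integer n ≥ 1 (the theta series of the Gross lattices are equal); (c) there exists a ℤ-module isomorphism φ : O^T → O'^T such that Nr(φ(h)) = Nr(h) for all h ∈ O^T (the associated ternary quadratic forms are ℤ-equivalent). -/

import Mathlib

open Quaternion Polynomial

variable {c₁ c₂ : ℚ}

/-- The reduced norm on a quaternion algebra over ℚ. -/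
noncomputable def Nr (x : ℍ[ℚ, c₁, c₂]) : ℚ := (x * star x).re

/-- The reduced trace on a quaternion algebra over ℚ. -/
noncomputable def Trd (x : ℍ[ℚ, c₁, c₂]) : ℚ := (x + star x).re

/-- An order of the quaternion algebra: a subring (ℤ-subalgebra) which is finitely
generated as a ℤ-module and contains a ℚ-basis, i.e. spans the algebra over ℚ. -/
def IsOrder (O : Subalgebra ℤ ℍ[ℚ, c₁, c₂]) : Prop :=
  (Subalgebra.toSubmodule O).FG ∧ Submodule.span ℚ (O : Set ℍ[ℚ, c₁, c₂]) = ⊤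

/-- A maximal order: an order not properly contained in another order. -/
def IsMaximalOrder (O : Subalgebra ℤ ℍ[ℚ, c₁, c₂]) : Prop :=
  IsOrder O ∧ ∀ O' : Subalgebra ℤ ℍ[ℚ, c₁, c₂], IsOrder O' → O ≤ O' → O' = O

/-- The ℤ-linear map `x ↦ 2x - Tr(x)·1 = x - star x`. -/
noncomputable def grossMap : ℍ[ℚ, c₁, c₂] →ₗ[ℤ] ℍ[ℚ, c₁, c₂] where
  toFun x := 2 • x - (x + star x)
  map_add' x y := by
    simp only [star_add, smul_add]
    abel
  map_smul' k x := by
    simp only [QuaternionAlgebra.star_smul, RingHom.id_apply, smul_add, smul_sub, smul_comm k]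

/-- The Gross lattice `O^T = {2x - Tr(x)·1 : x ∈ O}` of an order. -/
noncomputable def GrossLattice (O : Subalgebra ℤ ℍ[ℚ, c₁, c₂]) :
    Submodule ℤ ℍ[ℚ, c₁, c₂] :=
  Submodule.map grossMap (Subalgebra.toSubmodule O)

/-- `h` is primitive in the ℤ-module `L` if `h ≠ k • h'` for every integer `k ≥ 2`
and every `h' ∈ L`. -/
def IsPrimitiveIn (L : Submodule ℤ ℍ[ℚ, c₁, c₂]) (h : ℍ[ℚ, c₁, c₂]) : Prop :=
  ∀ k : ℤ, 2 ≤ k → ∀ h' ∈ L, h ≠ k • h'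

/-- `r_{O^T}(n)`: the number of elements of the Gross lattice of reduced norm `n`. -/
noncomputable def rCount (O : Subalgebra ℤ ℍ[ℚ, c₁, c₂]) (n : ℕ) : ℕ :=
  Nat.card {h : ℍ[ℚ, c₁, c₂] // h ∈ GrossLattice O ∧ Nr h = n}

/-- `a_{O^T}(n)`: the number of primitive elements of the Gross lattice of reduced norm `n`. -/
noncomputable def aCount (O : Subalgebra ℤ ℍ[ℚ, c₁, c₂]) (n : ℕ) : ℕ :=
  Nat.card {h : ℍ[ℚ, c₁, c₂] //
    h ∈ GrossLattice O ∧ Nr h = n ∧ IsPrimitiveIn (GrossLattice O) h}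

/-- `B` is ramified exactly at `p` and `∞`: the real and `p`-adic completions are
division rings, while the `ℓ`-adic completion is not a division ring for `ℓ ≠ p`. -/
def RamifiedExactlyAt (p : ℕ) [Fact p.Prime] (c₁ c₂ : ℚ) : Prop :=
  (∀ x : ℍ[ℝ, (c₁ : ℝ), (c₂ : ℝ)], x ≠ 0 → ∃ y, x * y = 1 ∧ y * x = 1) ∧
  (∀ x : ℍ[ℚ_[p], (c₁ : ℚ_[p]), (c₂ : ℚ_[p])], x ≠ 0 → ∃ y, x * y = 1 ∧ y * x = 1) ∧
  ∀ (ℓ : ℕ) [Fact ℓ.Prime], ℓ ≠ p →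
    ¬ (∀ x : ℍ[ℚ_[ℓ], (c₁ : ℚ_[ℓ]), (c₂ : ℚ_[ℓ])], x ≠ 0 → ∃ y, x * y = 1 ∧ y * x = 1)

/-- The relations satisfied by a basis `1, i, j, k` of the even Clifford algebra of the ternary
form `a x² + b y² + c z² + u y z + v x z + w x y`. -/
structure IsGoodBasis {A : Type*} [Ring A] [StarRing A] (i j k : A) (a b c u v w : ℤ) : Prop where
  star_i : star i = u • 1 - i
  star_j : star j = v • 1 - j
  star_k : star k = w • 1 - k
  ii : i * i = u • i - (b * c) • 1
  jj : j * j = v • j - (a * c) • 1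
  kk : k * k = w • k - (a * b) • 1
  jk : j * k = (a * u) • 1 - a • i
  ki : k * i = (b * v) • 1 - b • j
  ij : i * j = (c * w) • 1 - c • k
  kj : k * j = a • i - (w * v) • 1 + w • j + v • k
  ik : i * k = b • j - (u * w) • 1 + u • k + w • i
  ji : j * i = c • k - (u * v) • 1 + u • j + v • i

/-- The norm form `Nr(n + αi + βj + γk)` in a good basis. -/
def goodNorm {R : Type*} [CommRing R] (a b c u v w n α β γ : R) : R :=
  n ^ 2 + b * c * α ^ 2 + a * c * β ^ 2 + a * b * γ ^ 2 + n * (α * u + β * v + γ * w)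
    + α * β * (u * v - c * w) + α * γ * (u * w - b * v) + β * γ * (v * w - a * u)

/-- The half-discriminant of a ternary form. -/
def halfDisc {R : Type*} [CommRing R] (a b c u v w : R) : R :=
  4 * a * b * c + u * v * w - a * u ^ 2 - b * v ^ 2 - c * w ^ 2

namespace IsGoodBasis

section
variable {A : Type*} [Ring A] [StarRing A] {i j k : A} {a b c u v w : ℤ}

theorem cycle (h : IsGoodBasis i j k a b c u v w) : IsGoodBasis j k i b c a v w u where
  star_i := h.star_j
  star_j := h.star_k
  star_k := h.star_i
  ii := by rw [h.jj, mul_comm a c]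
  jj := by rw [h.kk, mul_comm a b]
  kk := h.ii
  jk := h.ki
  ki := h.ij
  ij := h.jk
  kj := h.ik
  ik := by rw [h.ji]; module
  ji := by rw [h.kj]; module

set_option linter.unusedSimpArgs false in
theorem shear (h : IsGoodBasis i j k a b c u v w) (s t : ℤ) :
    IsGoodBasis (i + s • (w • 1 - k) + (t * b) • 1) (j + (s * a) • 1 + t • (w • 1 - k)) k
      a b (c + s ^ 2 * a + t ^ 2 * b + s * v + t * u + s * t * w)
      (u + s * w + 2 * t * b) (v + 2 * s * a + t * w) w := by
  constructor
  all_goals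
    simp only [star_add, star_sub, star_zsmul, star_one, h.star_i, h.star_j, h.star_k,
      mul_add, add_mul, mul_sub, sub_mul, smul_mul_assoc, mul_smul_comm, one_mul, mul_one,
      h.ii, h.jj, h.kk, h.jk, h.ki, h.ij, h.kj, h.ik, h.ji]
    try module

/-- The ternary form divided by `m` on the sublattice spanned by `e₁, e₂, m e₃`. -/
theorem div_k [IsAddTorsionFree A] {m : ℤ} (hm : m ≠ 0) {k : A}
    (h : IsGoodBasis i j (m • k) (m * a) (m * b) c u v (m * w)) :
    IsGoodBasis i j k a b (m * c) u v w := by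
  have inj : ∀ x y : A, m • x = m • y → x = y := fun x y hxy => zsmul_right_injective hm hxy
  have hs := h.star_k
  have hjk := h.jk
  have hki := h.ki
  have hkj := h.kj
  have hik := h.ik
  have hkk := h.kk
  simp only [smul_mul_assoc, mul_smul_comm, star_zsmul] at hs hjk hki hkj hik hkk
  constructor
  · exact h.star_i
  · exact h.star_j
  · apply inj; rw [hs]; module
  · rw [h.ii]; module
  · rw [h.jj]; module
  · apply inj; apply inj; rw [hkk]; module
  · apply inj; rw [hjk]; module
  · apply inj; rw [hki]; module
  · rw [h.ij]; module
  · apply inj; rw [hkj]; module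
  · apply inj; rw [hik]; module
  · rw [h.ji]; module

/-- The ternary form on the overlattice spanned by `e₁, e₂, m⁻¹ e₃`. -/
theorem div_ij [IsAddTorsionFree A] {m : ℤ} (hm : m ≠ 0) {i j : A}
    (h : IsGoodBasis (m • i) (m • j) k a b (m ^ 2 * c) (m * u) (m * v) w) :
    IsGoodBasis i j k a b c u v w := by
  have inj : ∀ x y : A, m • x = m • y → x = y := fun x y hxy => zsmul_right_injective hm hxy
  have hsi := h.star_i
  have hsj := h.star_j
  have hii := h.ii
  have hjj := h.jj
  have hij := h.ij
  have hji := h.ji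
  have hjk := h.jk
  have hki := h.ki
  have hkj := h.kj
  have hik := h.ik
  simp only [smul_mul_assoc, mul_smul_comm, star_zsmul] at hsi hsj hii hjj hij hji hjk hki hkj hik
  constructor
  · apply inj; rw [hsi]; module
  · apply inj; rw [hsj]; module
  · exact h.star_k
  · apply inj; apply inj; rw [hii]; module
  · apply inj; apply inj; rw [hjj]; module
  · exact h.kk
  · apply inj; rw [hjk]; module
  · apply inj; rw [hki]; module
  · apply inj; apply inj; rw [hij]; module
  · apply inj; rw [hkj]; module
  · apply inj; rw [hik]; module
  · apply inj; apply inj; rw [hji]; module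

set_option linter.unusedSimpArgs false in
theorem mul_star (h : IsGoodBasis i j k a b c u v w) {R : Type*} [CommRing R] [Algebra R A]
    (n α β γ : R) :
    (n • (1 : A) + α • i + β • j + γ • k) *
      (n • (1 : A) + α • (u • 1 - i) + β • (v • 1 - j) + γ • (w • 1 - k)) =
      goodNorm (a : R) b c u v w n α β γ • (1 : A) := by
  simp only [mul_add, add_mul, mul_sub, sub_mul, smul_mul_assoc, mul_smul_comm, one_mul, mul_one,
      h.ii, h.jj, h.kk, h.jk, h.ki, h.ij, h.kj, h.ik, h.ji, goodNorm]
  module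

/-- The multiplicatively closed lattice spanned by a good basis. -/
def order (h : IsGoodBasis i j k a b c u v w) : Subalgebra ℤ A where
  carrier := {x | ∃ n α β γ : ℤ, x = n • (1 : A) + α • i + β • j + γ • k}
  mul_mem' := by
    rintro _ _ ⟨n, α, β, γ, rfl⟩ ⟨n', α', β', γ', rfl⟩
    refine ⟨n * n' - b * c * (α * α') - a * c * (β * β') - a * b * (γ * γ') + a * u * (β * γ')
      + b * v * (γ * α') + c * w * (α * β') - w * v * (γ * β') - u * w * (α * γ')
      - u * v * (β * α'),
      n * α' + α * n' + u * (α * α') - a * (β * γ') + a * (γ * β') + w * (α * γ') + v * (β * α'),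
      n * β' + β * n' + v * (β * β') - b * (γ * α') + w * (γ * β') + b * (α * γ') + u * (β * α'),
      n * γ' + γ * n' + w * (γ * γ') - c * (α * β') + v * (γ * β') + u * (α * γ') + c * (β * α'),
      ?_⟩
    simp only [mul_add, add_mul, smul_mul_assoc, mul_smul_comm, one_mul, mul_one,
      h.ii, h.jj, h.kk, h.jk, h.ki, h.ij, h.kj, h.ik, h.ji]
    module
  add_mem' := by
    rintro _ _ ⟨n, α, β, γ, rfl⟩ ⟨n', α', β', γ', rfl⟩
    exact ⟨n + n', α + α', β + β', γ + γ', by module⟩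
  algebraMap_mem' r := ⟨r, 0, 0, 0, by simp⟩

end

end IsGoodBasis

instance : IsAddTorsionFree ℍ[ℚ, c₁, c₂] := IsAddTorsionFree.of_module_rat _

namespace IsGoodBasis

variable {i j k : ℍ[ℚ, c₁, c₂]} {a b c u v w : ℤ}

theorem span_eq_top (h : IsGoodBasis i j k a b c u v w)
    (hs : Submodule.span ℚ (h.order : Set ℍ[ℚ, c₁, c₂]) = ⊤) :
    ⊤ ≤ Submodule.span ℚ (Set.range ![1, i, j, k]) := by
  rw [← hs, Submodule.span_le]
  rintro _ ⟨n, α, β, γ, rfl⟩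
  have key : ∀ l : Fin 4, ![1, i, j, k] l ∈ Submodule.span ℚ (Set.range ![1, i, j, k]) :=
    fun l => Submodule.subset_span ⟨l, rfl⟩
  simp only [← Int.cast_smul_eq_zsmul ℚ]
  exact Submodule.add_mem _ (Submodule.add_mem _ (Submodule.add_mem _
    (Submodule.smul_mem _ _ (key 0)) (Submodule.smul_mem _ _ (key 1)))
    (Submodule.smul_mem _ _ (key 2))) (Submodule.smul_mem _ _ (key 3))

theorem linearIndependent (h : IsGoodBasis i j k a b c u v w)
    (hs : Submodule.span ℚ (h.order : Set ℍ[ℚ, c₁, c₂]) = ⊤) :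
    LinearIndependent ℚ ![1, i, j, k] :=
  linearIndependent_of_top_le_span_of_card_eq_finrank (h.span_eq_top hs)
    (by rw [QuaternionAlgebra.finrank_eq_four, Fintype.card_fin])

theorem coords_unique (h : IsGoodBasis i j k a b c u v w)
    (hs : Submodule.span ℚ (h.order : Set ℍ[ℚ, c₁, c₂]) = ⊤) {n α β γ n' α' β' γ' : ℚ}
    (he : n • (1 : ℍ[ℚ, c₁, c₂]) + α • i + β • j + γ • k =
      n' • (1 : ℍ[ℚ, c₁, c₂]) + α' • i + β' • j + γ' • k) :
    n = n' ∧ α = α' ∧ β = β' ∧ γ = γ' := by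
  have := Fintype.linearIndependent_iff.1 (h.linearIndependent hs)
    ![n - n', α - α', β - β', γ - γ'] (by
      simp only [Fin.sum_univ_four, Matrix.cons_val]
      rw [← sub_eq_zero] at he
      rw [← he]
      module)
  exact ⟨sub_eq_zero.1 (this 0), sub_eq_zero.1 (this 1), sub_eq_zero.1 (this 2),
    sub_eq_zero.1 (this 3)⟩

theorem fg_order (h : IsGoodBasis i j k a b c u v w) : (Subalgebra.toSubmodule h.order).FG := by
  refine Submodule.fg_def.2 ⟨{1, i, j, k}, by simp, ?_⟩
  apply le_antisymm
  · rw [Submodule.span_le]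
    rintro x (rfl | rfl | rfl | rfl)
    · exact ⟨1, 0, 0, 0, by simp⟩
    · exact ⟨0, 1, 0, 0, by simp⟩
    · exact ⟨0, 0, 1, 0, by simp⟩
    · exact ⟨0, 0, 0, 1, by simp⟩
  · rintro _ ⟨n, α, β, γ, rfl⟩
    refine add_mem (add_mem (add_mem ?_ ?_) ?_) ?_ <;>
    exact Submodule.smul_mem _ _ (Submodule.subset_span (by simp))

end IsGoodBasis

/-- `O` is the even Clifford algebra of the form `a x² + b y² + c z² + u y z + v x z + w x y`. -/
def IsCliffordOrder (O : Subalgebra ℤ ℍ[ℚ, c₁, c₂]) (a b c u v w : ℤ) : Prop :=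
  ∃ i j k, ∃ h : IsGoodBasis i j k a b c u v w, h.order = O

namespace IsCliffordOrder

variable {O : Subalgebra ℤ ℍ[ℚ, c₁, c₂]} {a b c u v w : ℤ}

theorem cycle (h : IsCliffordOrder O a b c u v w) : IsCliffordOrder O b c a v w u := by
  obtain ⟨i, j, k, h, rfl⟩ := h
  refine ⟨j, k, i, h.cycle, ?_⟩
  ext x
  constructor
  · rintro ⟨n, α, β, γ, rfl⟩; exact ⟨n, γ, α, β, by abel⟩
  · rintro ⟨n, α, β, γ, rfl⟩; exact ⟨n, β, γ, α, by abel⟩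

theorem shear (h : IsCliffordOrder O a b c u v w) (s t : ℤ) :
    IsCliffordOrder O a b (c + s ^ 2 * a + t ^ 2 * b + s * v + t * u + s * t * w)
      (u + s * w + 2 * t * b) (v + 2 * s * a + t * w) w := by
  obtain ⟨i, j, k, h, rfl⟩ := h
  refine ⟨_, _, _, h.shear s t, ?_⟩
  ext x
  constructor
  · rintro ⟨n, α, β, γ, rfl⟩
    exact ⟨n + α * (s * w + t * b) + β * (s * a + t * w), α, β, γ - α * s - β * t, by module⟩
  · rintro ⟨n, α, β, γ, rfl⟩
    exact ⟨n - α * (s * w + t * b) - β * (s * a + t * w), α, β, γ + α * s + β * t, by module⟩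

theorem not_dvd_plane (h : IsCliffordOrder O a b c u v w) (hO : IsMaximalOrder O) {m : ℤ}
    (hm : Prime m) : ¬ (m ∣ a ∧ m ∣ b ∧ m ∣ w) := by
  rintro ⟨⟨a, rfl⟩, ⟨b, rfl⟩, ⟨w, rfl⟩⟩
  obtain ⟨i, j, k, h, rfl⟩ := h
  have hm0 : (m : ℚ) ≠ 0 := by exact_mod_cast hm.ne_zero
  obtain ⟨k, rfl⟩ : ∃ k', k = m • k' :=
    ⟨(m : ℚ)⁻¹ • k, by rw [← Int.cast_smul_eq_zsmul ℚ, smul_inv_smul₀ hm0]⟩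
  have hle : h.order ≤ (h.div_k hm.ne_zero).order := by
    rintro _ ⟨n, α, β, γ, rfl⟩
    exact ⟨n, α, β, γ * m, by module⟩
  have heq := hO.2 _ ⟨(h.div_k hm.ne_zero).fg_order,
    top_unique (hO.1.2.symm.le.trans (Submodule.span_mono hle))⟩ hle
  have hk : k ∈ h.order := by rw [← heq]; exact ⟨0, 0, 0, 1, by simp⟩
  obtain ⟨n, α, β, γ, hk⟩ := hk
  have := h.coords_unique hO.1.2 (n := 0) (α := 0) (β := 0) (γ := (m : ℚ)⁻¹)
    (n' := n) (α' := α) (β' := β) (γ' := γ) (by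
      simp only [Int.cast_smul_eq_zsmul]
      rw [← hk, ← Int.cast_smul_eq_zsmul ℚ, inv_smul_smul₀ hm0]; simp)
  have h1 : m * γ = 1 := by
    have := this.2.2.2
    field_simp at this
    exact_mod_cast this.symm
  exact hm.not_isUnit (IsUnit.of_mul_eq_one _ h1)

theorem not_sq_dvd (h : IsCliffordOrder O a b c u v w) (hO : IsMaximalOrder O) {m : ℤ}
    (hm : Prime m) : ¬ (m ^ 2 ∣ c ∧ m ∣ u ∧ m ∣ v) := by
  rintro ⟨⟨c, rfl⟩, ⟨u, rfl⟩, ⟨v, rfl⟩⟩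
  obtain ⟨i, j, k, h, rfl⟩ := h
  have hm0 : (m : ℚ) ≠ 0 := by exact_mod_cast hm.ne_zero
  obtain ⟨i, rfl⟩ : ∃ i', i = m • i' :=
    ⟨(m : ℚ)⁻¹ • i, by rw [← Int.cast_smul_eq_zsmul ℚ, smul_inv_smul₀ hm0]⟩
  obtain ⟨j, rfl⟩ : ∃ j', j = m • j' :=
    ⟨(m : ℚ)⁻¹ • j, by rw [← Int.cast_smul_eq_zsmul ℚ, smul_inv_smul₀ hm0]⟩
  have hle : h.order ≤ (h.div_ij hm.ne_zero).order := by
    rintro _ ⟨n, α, β, γ, rfl⟩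
    exact ⟨n, α * m, β * m, γ, by module⟩
  have heq := hO.2 _ ⟨(h.div_ij hm.ne_zero).fg_order,
    top_unique (hO.1.2.symm.le.trans (Submodule.span_mono hle))⟩ hle
  have hi : i ∈ h.order := by rw [← heq]; exact ⟨0, 1, 0, 0, by simp⟩
  obtain ⟨n, α, β, γ, hi⟩ := hi
  have := h.coords_unique hO.1.2 (n := 0) (α := (m : ℚ)⁻¹) (β := 0) (γ := 0)
    (n' := n) (α' := α) (β' := β) (γ' := γ) (by
      simp only [Int.cast_smul_eq_zsmul]
      rw [← hi, ← Int.cast_smul_eq_zsmul ℚ, inv_smul_smul₀ hm0]; simp)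
  have h1 : m * α = 1 := by
    have := this.2.1
    field_simp at this
    exact_mod_cast this.symm
  exact hm.not_isUnit (IsUnit.of_mul_eq_one _ h1)

end IsCliffordOrder

theorem exists_degenerate_vector_two (a b c u v w : ZMod 2) (hd : halfDisc a b c u v w = 0) :
    ∃ x y z : ZMod 2, ¬ (x = 0 ∧ y = 0 ∧ z = 0) ∧
      a * x ^ 2 + b * y ^ 2 + c * z ^ 2 + u * y * z + v * x * z + w * x * y = 0 ∧
      2 * a * x + w * y + v * z = 0 ∧ w * x + 2 * b * y + u * z = 0 ∧
      v * x + u * y + 2 * c * z = 0 := by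
  unfold halfDisc at hd
  revert a b c u v w
  decide

theorem binary_disc_ne_zero_two (a b w : ZMod 2)
    (an : ∀ x y : ZMod 2, a * x ^ 2 + w * x * y + b * y ^ 2 = 0 → x = 0 ∧ y = 0) :
    4 * a * b - w ^ 2 ≠ 0 := by
  revert a b w
  decide

theorem exists_degenerate_vector {ℓ : ℕ} [hℓ : Fact ℓ.Prime] (a b c u v w : ZMod ℓ)
    (hd : halfDisc a b c u v w = 0) :
    ∃ x y z : ZMod ℓ, ¬ (x = 0 ∧ y = 0 ∧ z = 0) ∧
      a * x ^ 2 + b * y ^ 2 + c * z ^ 2 + u * y * z + v * x * z + w * x * y = 0 ∧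
      2 * a * x + w * y + v * z = 0 ∧ w * x + 2 * b * y + u * z = 0 ∧
      v * x + u * y + 2 * c * z = 0 := by
  by_cases h2 : ℓ = 2
  · subst h2
    exact exists_degenerate_vector_two a b c u v w hd
  · have h2' : (2 : ZMod ℓ) ≠ 0 := by
      intro h
      have : ((2 : ℕ) : ZMod ℓ) = 0 := by exact_mod_cast h
      rw [ZMod.natCast_eq_zero_iff] at this
      exact h2 ((Nat.prime_dvd_prime_iff_eq hℓ.out Nat.prime_two).1 this)
    obtain ⟨x, hx, hM⟩ := (Matrix.exists_mulVec_eq_zero_iff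
      (M := !![2 * a, w, v; w, 2 * b, u; v, u, 2 * c])).2 (by
        rw [Matrix.det_fin_three]
        simp only [Matrix.of_apply, Matrix.cons_val]
        unfold halfDisc at hd
        linear_combination 2 * hd)
    have e0 := congrFun hM 0
    have e1 := congrFun hM 1
    have e2 := congrFun hM 2
    simp only [Matrix.mulVec, dotProduct, Fin.sum_univ_three, Matrix.of_apply,
      Matrix.cons_val, Pi.zero_apply] at e0 e1 e2
    refine ⟨x 0, x 1, x 2, ?_, ?_, e0, e1, e2⟩
    · rintro ⟨h0, h1, h2⟩
      apply hx
      ext l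
      fin_cases l <;> assumption
    · apply (mul_eq_zero.1 _).resolve_left h2'
      linear_combination x 0 * e0 + x 1 * e1 + x 2 * e2

namespace IsCliffordOrder

variable {O : Subalgebra ℤ ℍ[ℚ, c₁, c₂]} {a b c u v w : ℤ}

theorem exists_degenerate_shear {ℓ : ℕ} [Fact ℓ.Prime] (h : IsCliffordOrder O a b c u v w)
    {x y z : ZMod ℓ} (hz : z ≠ 0)
    (hQ : a * x ^ 2 + b * y ^ 2 + c * z ^ 2 + u * y * z + v * x * z + w * x * y = 0)
    (h1 : 2 * a * x + w * y + v * z = 0) (h2 : w * x + 2 * b * y + u * z = 0) :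
    ∃ c' u' v', IsCliffordOrder O a b c' u' v' w ∧
      halfDisc a b c' u' v' w = halfDisc a b c u v w ∧
      (ℓ : ℤ) ∣ c' ∧ (ℓ : ℤ) ∣ u' ∧ (ℓ : ℤ) ∣ v' := by
  obtain ⟨s, hs⟩ := ZMod.intCast_surjective (x / z)
  obtain ⟨t, ht⟩ := ZMod.intCast_surjective (y / z)
  have hx : x = s * z := by rw [hs, div_mul_cancel₀ _ hz]
  have hy : y = t * z := by rw [ht, div_mul_cancel₀ _ hz]
  subst hx hy
  refine ⟨_, _, _, h.shear s t, by unfold halfDisc; ring, ?_, ?_, ?_⟩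
  all_goals rw [← ZMod.intCast_zmod_eq_zero_iff_dvd]; push_cast
  · apply (mul_eq_zero.1 _).resolve_right (pow_ne_zero 2 hz)
    linear_combination hQ
  · apply (mul_eq_zero.1 _).resolve_right hz
    linear_combination h2
  · apply (mul_eq_zero.1 _).resolve_right hz
    linear_combination h1

theorem exists_degenerate {ℓ : ℕ} [Fact ℓ.Prime] (h : IsCliffordOrder O a b c u v w)
    (hd : (ℓ : ℤ) ∣ halfDisc a b c u v w) :
    ∃ a' b' c' u' v' w', IsCliffordOrder O a' b' c' u' v' w' ∧
      halfDisc a' b' c' u' v' w' = halfDisc a b c u v w ∧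
      (ℓ : ℤ) ∣ c' ∧ (ℓ : ℤ) ∣ u' ∧ (ℓ : ℤ) ∣ v' := by
  obtain ⟨x, y, z, hne, hQ, h1, h2, h3⟩ := exists_degenerate_vector
    (a : ZMod ℓ) b c u v w (by
      rw [← ZMod.intCast_zmod_eq_zero_iff_dvd] at hd
      rw [← hd]; simp [halfDisc])
  by_cases hz : z = 0
  · by_cases hx : x = 0
    · have hy : y ≠ 0 := fun hy => hne ⟨hx, hy, hz⟩
      obtain ⟨c', u', v', h', hd', hc⟩ := h.cycle.cycle.exists_degenerate_shear
        (x := z) (y := x) hy (by linear_combination hQ) (by linear_combination h3)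
        (by linear_combination h1)
      exact ⟨_, _, c', u', v', _, h', by rw [hd']; unfold halfDisc; ring, hc⟩
    · obtain ⟨c', u', v', h', hd', hc⟩ := h.cycle.exists_degenerate_shear
        (x := y) (y := z) hx (by linear_combination hQ) (by linear_combination h2)
        (by linear_combination h3)
      exact ⟨_, _, c', u', v', _, h', by rw [hd']; unfold halfDisc; ring, hc⟩
  · obtain ⟨c', u', v', h', hd', hc⟩ := h.exists_degenerate_shear hz hQ h1 h2
    exact ⟨_, _, c', u', v', _, h', hd', hc⟩

theorem binary_anisotropic {ℓ : ℕ} [hℓ : Fact ℓ.Prime] (h : IsCliffordOrder O a b c u v w)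
    (hO : IsMaximalOrder O) (hc : (ℓ : ℤ) ∣ c) (hu : (ℓ : ℤ) ∣ u) (hv : (ℓ : ℤ) ∣ v)
    {x y : ZMod ℓ} (hxy : a * x ^ 2 + w * x * y + b * y ^ 2 = 0) : x = 0 ∧ y = 0 := by
  have hp : Prime (ℓ : ℤ) := Nat.prime_iff_prime_int.1 hℓ.out
  by_cases hy : y = 0
  · refine ⟨?_, hy⟩
    by_contra hx
    refine h.cycle.cycle.not_dvd_plane hO hp ⟨hc, ?_, hv⟩
    rw [← ZMod.intCast_zmod_eq_zero_iff_dvd]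
    apply (mul_eq_zero.1 _).resolve_right (pow_ne_zero 2 hx)
    simpa [hy] using hxy
  · exfalso
    obtain ⟨s, hs⟩ := ZMod.intCast_surjective (x / y)
    have hx : x = s * y := by rw [hs, div_mul_cancel₀ _ hy]
    subst hx
    refine (h.cycle.cycle.shear 0 s).cycle.cycle.not_dvd_plane hO hp ⟨?_, hc, ?_⟩
    · rw [← ZMod.intCast_zmod_eq_zero_iff_dvd]
      apply (mul_eq_zero.1 _).resolve_right (pow_ne_zero 2 hy)
      push_cast
      linear_combination hxy
    · simpa using dvd_add hu (Dvd.dvd.mul_left hv s)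

theorem not_dvd_binary_disc {ℓ : ℕ} [hℓ : Fact ℓ.Prime] (h : IsCliffordOrder O a b c u v w)
    (hO : IsMaximalOrder O) (hc : (ℓ : ℤ) ∣ c) (hu : (ℓ : ℤ) ∣ u) (hv : (ℓ : ℤ) ∣ v) :
    ¬ (ℓ : ℤ) ∣ 4 * a * b - w ^ 2 := by
  intro hD
  have an : ∀ x y : ZMod ℓ, a * x ^ 2 + w * x * y + b * y ^ 2 = 0 → x = 0 ∧ y = 0 :=
    fun x y => h.binary_anisotropic hO hc hu hv
  rw [← ZMod.intCast_zmod_eq_zero_iff_dvd] at hD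
  push_cast at hD
  generalize (a : ZMod ℓ) = a at *
  generalize (b : ZMod ℓ) = b at *
  generalize (w : ZMod ℓ) = w at *
  by_cases h2 : (2 : ZMod ℓ) = 0
  · have : ((2 : ℕ) : ZMod ℓ) = 0 := by exact_mod_cast h2
    rw [ZMod.natCast_eq_zero_iff] at this
    obtain rfl := (Nat.prime_dvd_prime_iff_eq hℓ.out Nat.prime_two).1 this
    exact binary_disc_ne_zero_two a b w an hD
  · have ha := (an w (-2 * a) (by linear_combination a * hD)).2
    have ha : a = 0 := by simpa [h2] using ha
    exact one_ne_zero (an 1 0 (by simp [ha])).1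

theorem not_sq_dvd_halfDisc {ℓ : ℕ} [hℓ : Fact ℓ.Prime] (h : IsCliffordOrder O a b c u v w)
    (hO : IsMaximalOrder O) : ¬ (ℓ : ℤ) ^ 2 ∣ halfDisc a b c u v w := by
  intro hd
  have hp : Prime (ℓ : ℤ) := Nat.prime_iff_prime_int.1 hℓ.out
  obtain ⟨a, b, c, u, v, w, h, he, hc, hu, hv⟩ :=
    h.exists_degenerate (dvd_trans (dvd_pow_self _ two_ne_zero) hd)
  rw [← he] at hd
  refine h.not_sq_dvd hO hp ⟨?_, hu, hv⟩
  have hD := h.not_dvd_binary_disc hO hc hu hv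
  refine hp.pow_dvd_of_dvd_mul_right 2 hD ?_
  obtain ⟨u, rfl⟩ := hu
  obtain ⟨v, rfl⟩ := hv
  have : c * (4 * a * b - w ^ 2) = halfDisc a b c (ℓ * u) (ℓ * v) w -
      ℓ ^ 2 * (u * v * w - a * u ^ 2 - b * v ^ 2) := by unfold halfDisc; ring
  rw [this]
  exact dvd_sub hd (dvd_mul_right _ _)

end IsCliffordOrder

theorem PadicInt.toZMod_eq_zero_iff_dvd {ℓ : ℕ} [Fact ℓ.Prime] (x : ℤ_[ℓ]) :
    PadicInt.toZMod x = 0 ↔ (ℓ : ℤ_[ℓ]) ∣ x := by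
  rw [← RingHom.mem_ker, PadicInt.ker_toZMod, PadicInt.maximalIdeal_eq_span_p,
    Ideal.mem_span_singleton]

theorem map_goodNorm {R S : Type*} [CommRing R] [CommRing S] (f : R →+* S)
    (a b c u v w n α β γ : R) : f (goodNorm a b c u v w n α β γ) =
      goodNorm (f a) (f b) (f c) (f u) (f v) (f w) (f n) (f α) (f β) (f γ) := by
  simp [goodNorm]

theorem IsCliffordOrder.dvd_of_goodNorm_eq_zero {O : Subalgebra ℤ ℍ[ℚ, c₁, c₂]}
    {a b c u v w : ℤ} {ℓ : ℕ} [hℓ : Fact ℓ.Prime] (h : IsCliffordOrder O a b c u v w)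
    (hO : IsMaximalOrder O) (hc : (ℓ : ℤ) ∣ c) (hu : (ℓ : ℤ) ∣ u) (hv : (ℓ : ℤ) ∣ v)
    {n α β γ : ℤ_[ℓ]} (hN : goodNorm (a : ℤ_[ℓ]) b c u v w n α β γ = 0) :
    (ℓ : ℤ_[ℓ]) ∣ n ∧ (ℓ : ℤ_[ℓ]) ∣ α ∧ (ℓ : ℤ_[ℓ]) ∣ β ∧ (ℓ : ℤ_[ℓ]) ∣ γ := by
  have hp : Prime (ℓ : ℤ) := Nat.prime_iff_prime_int.1 hℓ.out
  have an : ∀ x y : ZMod ℓ, a * x ^ 2 + w * x * y + b * y ^ 2 = 0 → x = 0 ∧ y = 0 :=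
    fun x y => h.binary_anisotropic hO hc hu hv
  have hc2 : ¬ (ℓ : ℤ) ^ 2 ∣ c := fun hc2 => h.not_sq_dvd hO hp ⟨hc2, hu, hv⟩
  have hl0 : (ℓ : ℤ_[ℓ]) ≠ 0 := by exact_mod_cast hℓ.out.ne_zero
  obtain ⟨c, rfl⟩ := hc
  obtain ⟨u, rfl⟩ := hu
  obtain ⟨v, rfl⟩ := hv
  have hc' : (c : ZMod ℓ) ≠ 0 := by
    rw [Ne, ZMod.intCast_zmod_eq_zero_iff_dvd]
    rintro ⟨c, rfl⟩
    exact hc2 ⟨c, by ring⟩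
  have ha : (a : ZMod ℓ) ≠ 0 := fun ha => one_ne_zero (an 1 0 (by simp [ha])).1
  have e1 := congrArg PadicInt.toZMod hN
  rw [map_goodNorm] at e1
  simp only [goodNorm, map_intCast, Int.cast_mul, Int.cast_natCast, map_mul, map_natCast,
    CharP.cast_eq_zero, map_zero] at e1
  obtain ⟨hn, hγ⟩ := an (PadicInt.toZMod n) (a * PadicInt.toZMod γ)
    (by linear_combination (a : ZMod ℓ) * e1)
  replace hγ := (mul_eq_zero.1 hγ).resolve_left ha
  rw [PadicInt.toZMod_eq_zero_iff_dvd] at hn hγ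
  refine ⟨hn, and_assoc.1 ⟨?_, hγ⟩⟩
  obtain ⟨n, rfl⟩ := hn
  obtain ⟨γ, rfl⟩ := hγ
  have e2 : c * (a * β ^ 2 + w * β * (-α) + b * (-α) ^ 2) + ℓ * (n ^ 2 + a * b * γ ^ 2
      + n * (α * u + β * v + γ * w) + α * β * (u * v) + α * γ * (u * w - b * v)
      + β * γ * (v * w - a * u)) = 0 := by
    apply (mul_eq_zero.1 _).resolve_left hl0
    rw [← hN]
    simp only [goodNorm, Int.cast_mul, Int.cast_natCast]
    ring
  have e3 := congrArg PadicInt.toZMod e2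
  simp only [map_add, map_mul, map_pow, map_neg, map_natCast, map_intCast, map_zero,
    CharP.cast_eq_zero, zero_mul, add_zero] at e3
  obtain ⟨hβ, hα⟩ := an _ _ ((mul_eq_zero.1 e3).resolve_left hc')
  rw [neg_eq_zero] at hα
  exact ⟨(PadicInt.toZMod_eq_zero_iff_dvd _).1 hα, (PadicInt.toZMod_eq_zero_iff_dvd _).1 hβ⟩

theorem IsCliffordOrder.eq_zero_of_goodNorm_eq_zero {O : Subalgebra ℤ ℍ[ℚ, c₁, c₂]}
    {a b c u v w : ℤ} {ℓ : ℕ} [hℓ : Fact ℓ.Prime] (h : IsCliffordOrder O a b c u v w)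
    (hO : IsMaximalOrder O) (hc : (ℓ : ℤ) ∣ c) (hu : (ℓ : ℤ) ∣ u) (hv : (ℓ : ℤ) ∣ v)
    (x : Fin 4 → ℚ_[ℓ])
    (hN : goodNorm (a : ℚ_[ℓ]) b c u v w (x 0) (x 1) (x 2) (x 3) = 0) : x = 0 := by
  by_contra hx
  obtain ⟨m, hm⟩ := exists_eq_ciSup_of_finite (f := fun l => ‖x l‖)
  have hle : ∀ l, ‖x l‖ ≤ ‖x m‖ := fun l => by
    rw [hm]; exact le_ciSup (f := fun l => ‖x l‖) (Set.finite_range _).bddAbove l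
  have hm0 : x m ≠ 0 := by
    intro h0
    apply hx
    ext l
    simpa [h0] using hle l
  have hpos := norm_pos_iff.2 hm0
  let y : Fin 4 → ℤ_[ℓ] := fun l => ⟨x l / x m, by
    rw [norm_div, div_le_one hpos]; exact hle l⟩
  have hy : ∀ l, ((y l : ℤ_[ℓ]) : ℚ_[ℓ]) = x l / x m := fun l => rfl
  have hyN : goodNorm (a : ℤ_[ℓ]) b c u v w (y 0) (y 1) (y 2) (y 3) = 0 := by
    apply PadicInt.ext
    have e : ((goodNorm (a : ℤ_[ℓ]) b c u v w (y 0) (y 1) (y 2) (y 3) : ℤ_[ℓ]) : ℚ_[ℓ]) =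
        goodNorm (a : ℚ_[ℓ]) b c u v w (x 0 / x m) (x 1 / x m) (x 2 / x m) (x 3 / x m) := by
      simp only [← hy, goodNorm]
      push_cast
      ring
    rw [PadicInt.coe_zero, e]
    have : goodNorm (a : ℚ_[ℓ]) b c u v w (x 0 / x m) (x 1 / x m) (x 2 / x m) (x 3 / x m) =
        goodNorm (a : ℚ_[ℓ]) b c u v w (x 0) (x 1) (x 2) (x 3) / x m ^ 2 := by
      unfold goodNorm; field_simp
    rw [this, hN, zero_div]
  have hdvd := h.dvd_of_goodNorm_eq_zero hO hc hu hv hyN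
  have hm1 : y m = 1 := by
    apply PadicInt.ext
    exact div_self hm0
  have : (ℓ : ℤ_[ℓ]) ∣ y m := by
    obtain ⟨h0, h1, h2, h3⟩ := hdvd
    fin_cases m <;> assumption
  rw [hm1] at this
  exact PadicInt.prime_p.not_isUnit (isUnit_of_dvd_one this)

theorem PadicInt.exists_root_quadratic {p : ℕ} [hp : Fact p.Prime] (A B C t₀ : ℤ_[p])
    (h0 : PadicInt.toZMod (A * t₀ ^ 2 + B * t₀ + C) = 0)
    (h1 : PadicInt.toZMod (2 * A * t₀ + B) ≠ 0) :
    ∃ t, A * t ^ 2 + B * t + C = 0 ∧ PadicInt.toZMod t = PadicInt.toZMod t₀ := by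
  let F : ℤ_[p][X] := Polynomial.C A * X ^ 2 + Polynomial.C B * X + Polynomial.C C
  have hF : ∀ t, F.aeval t = A * t ^ 2 + B * t + C := fun t => by simp [F]
  have hF' : ∀ t, F.derivative.aeval t = 2 * A * t + B := fun t => by
    simp [F]; ring
  have n0 : ‖F.aeval t₀‖ < 1 := by
    rw [hF, PadicInt.norm_lt_one_iff_dvd, ← PadicInt.toZMod_eq_zero_iff_dvd]; exact h0
  have n1 : ‖F.derivative.aeval t₀‖ = 1 := by
    refine le_antisymm (PadicInt.norm_le_one _) (not_lt.1 ?_)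
    rw [hF', PadicInt.norm_lt_one_iff_dvd, ← PadicInt.toZMod_eq_zero_iff_dvd]; exact h1
  obtain ⟨t, ht, hd, -⟩ := hensels_lemma (F := F) (a := t₀) (by rw [n1]; simpa using n0)
  refine ⟨t, by rw [← hF]; exact ht, ?_⟩
  rw [n1, PadicInt.norm_lt_one_iff_dvd, ← PadicInt.toZMod_eq_zero_iff_dvd, map_sub,
    sub_eq_zero] at hd
  exact hd

theorem exists_goodNorm_eq_zero_zmod {p : ℕ} [hp : Fact p.Prime] (a b c u v w : ZMod p) :
    ∃ x : Fin 4 → ZMod p, x ≠ 0 ∧ goodNorm a b c u v w (x 0) (x 1) (x 2) (x 3) = 0 := by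
  classical
  let f : MvPolynomial (Fin 4) (ZMod p) := goodNorm (MvPolynomial.C a) (MvPolynomial.C b)
    (MvPolynomial.C c) (MvPolynomial.C u) (MvPolynomial.C v) (MvPolynomial.C w)
    (MvPolynomial.X 0) (MvPolynomial.X 1) (MvPolynomial.X 2) (MvPolynomial.X 3)
  have hev : ∀ x, MvPolynomial.eval x f = goodNorm a b c u v w (x 0) (x 1) (x 2) (x 3) :=
    fun x => by simp [f, map_goodNorm]
  have hdeg : f.totalDegree < Fintype.card (Fin 4) := by
    have : f.IsHomogeneous 2 := by
      have hX := fun l : Fin 4 => MvPolynomial.isHomogeneous_X (ZMod p) l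
      have hXX : ∀ l m : Fin 4, MvPolynomial.IsHomogeneous
          (MvPolynomial.X l * MvPolynomial.X m : MvPolynomial (Fin 4) (ZMod p)) 2 :=
        fun l m => (hX l).mul (hX m)
      have hC : ∀ (r : ZMod p) (l m : Fin 4), MvPolynomial.IsHomogeneous
          (MvPolynomial.C r * (MvPolynomial.X l * MvPolynomial.X m) :
            MvPolynomial (Fin 4) (ZMod p)) 2 := fun r l m => (hXX l m).C_mul r
      have : f = MvPolynomial.C 1 * (MvPolynomial.X 0 * MvPolynomial.X 0)
        + MvPolynomial.C (b * c) * (MvPolynomial.X 1 * MvPolynomial.X 1)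
        + MvPolynomial.C (a * c) * (MvPolynomial.X 2 * MvPolynomial.X 2)
        + MvPolynomial.C (a * b) * (MvPolynomial.X 3 * MvPolynomial.X 3)
        + MvPolynomial.C u * (MvPolynomial.X 0 * MvPolynomial.X 1)
        + MvPolynomial.C v * (MvPolynomial.X 0 * MvPolynomial.X 2)
        + MvPolynomial.C w * (MvPolynomial.X 0 * MvPolynomial.X 3)
        + MvPolynomial.C (u * v - c * w) * (MvPolynomial.X 1 * MvPolynomial.X 2)
        + MvPolynomial.C (u * w - b * v) * (MvPolynomial.X 1 * MvPolynomial.X 3)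
        + MvPolynomial.C (v * w - a * u) * (MvPolynomial.X 2 * MvPolynomial.X 3) := by
        simp only [f, goodNorm, map_sub, map_mul, map_one]; ring
      rw [this]
      exact (((((((((hC _ _ _).add (hC _ _ _)).add (hC _ _ _)).add (hC _ _ _)).add
        (hC _ _ _)).add (hC _ _ _)).add (hC _ _ _)).add (hC _ _ _)).add (hC _ _ _)).add (hC _ _ _)
    exact this.totalDegree_le.trans_lt (by simp)
  have hdvd := char_dvd_card_solutions p hdeg
  by_contra! hcon
  have : Fintype.card {x : Fin 4 → ZMod p // MvPolynomial.eval x f = 0} = 1 := by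
    rw [Fintype.card_eq_one_iff]
    refine ⟨⟨0, by rw [hev]; simp [goodNorm]⟩, fun x => Subtype.ext ?_⟩
    by_contra hx
    exact hcon x.1 hx (by rw [← hev]; exact x.2)
  rw [this] at hdvd
  exact hp.out.one_lt.ne' (Nat.dvd_one.1 hdvd)

theorem goodNorm_gradient_ne_zero {K : Type*} [Field K] {a b c u v w n α β γ : K}
    (hd : halfDisc a b c u v w ≠ 0) (hne : ¬ (n = 0 ∧ α = 0 ∧ β = 0 ∧ γ = 0))
    (hN : goodNorm a b c u v w n α β γ = 0)
    (h0 : 2 * n + (α * u + β * v + γ * w) = 0)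
    (h1 : 2 * b * c * α + (n * u + β * (u * v - c * w) + γ * (u * w - b * v)) = 0)
    (h2 : 2 * a * c * β + (n * v + α * (u * v - c * w) + γ * (v * w - a * u)) = 0)
    (h3 : 2 * a * b * γ + (n * w + α * (u * w - b * v) + β * (v * w - a * u)) = 0) : False := by
  have hα : α = 0 := by
    apply (mul_eq_zero.1 _).resolve_left hd
    unfold halfDisc
    linear_combination (2 * a) * h1 + w * h2 + v * h3 - (a * u + v * w) * h0
  have hβ : β = 0 := by
    apply (mul_eq_zero.1 _).resolve_left hd
    unfold halfDisc
    linear_combination (2 * b) * h2 + u * h3 + w * h1 - (b * v + w * u) * h0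
  have hγ : γ = 0 := by
    apply (mul_eq_zero.1 _).resolve_left hd
    unfold halfDisc
    linear_combination (2 * c) * h3 + v * h1 + u * h2 - (c * w + u * v) * h0
  subst hα hβ hγ
  exact hne ⟨by simpa [goodNorm] using hN, rfl, rfl, rfl⟩

theorem exists_goodNorm_eq_zero_padic {p : ℕ} [hp : Fact p.Prime] (a b c u v w : ℤ_[p])
    (hd : ¬ (p : ℤ_[p]) ∣ halfDisc a b c u v w) :
    ∃ n α β γ : ℤ_[p], ¬ (n = 0 ∧ α = 0 ∧ β = 0 ∧ γ = 0) ∧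
      goodNorm a b c u v w n α β γ = 0 := by
  have h2 : PadicInt.toZMod (2 : ℤ_[p]) = 2 := map_ofNat _ 2
  have h4 : PadicInt.toZMod (4 : ℤ_[p]) = 4 := map_ofNat _ 4
  obtain ⟨x, hx, hN⟩ := exists_goodNorm_eq_zero_zmod (PadicInt.toZMod a) (PadicInt.toZMod b)
    (PadicInt.toZMod c) (PadicInt.toZMod u) (PadicInt.toZMod v) (PadicInt.toZMod w)
  obtain ⟨y, hy⟩ : ∃ y : Fin 4 → ℤ_[p], ∀ l, PadicInt.toZMod (y l) = x l :=
    ⟨fun l => (ZMod.ringHom_surjective PadicInt.toZMod (x l)).choose,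
      fun l => (ZMod.ringHom_surjective PadicInt.toZMod (x l)).choose_spec⟩
  have hx' : ¬ (x 0 = 0 ∧ x 1 = 0 ∧ x 2 = 0 ∧ x 3 = 0) := by
    rintro ⟨h0, h1, h2, h3⟩
    apply hx; ext l; fin_cases l <;> assumption
  have hd' : halfDisc (PadicInt.toZMod a) (PadicInt.toZMod b)
      (PadicInt.toZMod c) (PadicInt.toZMod u) (PadicInt.toZMod v) (PadicInt.toZMod w) ≠ 0 := by
    rw [← PadicInt.toZMod_eq_zero_iff_dvd] at hd
    refine fun h => hd (Eq.trans ?_ h)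
    simp [halfDisc, h4]
  have hgrad := goodNorm_gradient_ne_zero hd' hx' hN
  simp only [← hy] at hgrad hN hx'
  have lift : ∀ n α β γ, PadicInt.toZMod n = PadicInt.toZMod (y 0) →
      PadicInt.toZMod α = PadicInt.toZMod (y 1) → PadicInt.toZMod β = PadicInt.toZMod (y 2) →
      PadicInt.toZMod γ = PadicInt.toZMod (y 3) → ¬ (n = 0 ∧ α = 0 ∧ β = 0 ∧ γ = 0) := by
    rintro n α β γ h0 h1 h2 h3 ⟨rfl, rfl, rfl, rfl⟩
    rw [← h0, ← h1, ← h2, ← h3] at hx'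
    simp at hx'
  by_cases g0 : 2 * PadicInt.toZMod (y 0) + (PadicInt.toZMod (y 1) * PadicInt.toZMod u
      + PadicInt.toZMod (y 2) * PadicInt.toZMod v + PadicInt.toZMod (y 3) * PadicInt.toZMod w) = 0
  · by_cases g1 : 2 * PadicInt.toZMod b * PadicInt.toZMod c * PadicInt.toZMod (y 1) +
        (PadicInt.toZMod (y 0) * PadicInt.toZMod u
        + PadicInt.toZMod (y 2) * (PadicInt.toZMod u * PadicInt.toZMod v
          - PadicInt.toZMod c * PadicInt.toZMod w)
        + PadicInt.toZMod (y 3) * (PadicInt.toZMod u * PadicInt.toZMod w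
          - PadicInt.toZMod b * PadicInt.toZMod v)) = 0
    · by_cases g2 : 2 * PadicInt.toZMod a * PadicInt.toZMod c * PadicInt.toZMod (y 2) +
        (PadicInt.toZMod (y 0) * PadicInt.toZMod v
        + PadicInt.toZMod (y 1) * (PadicInt.toZMod u * PadicInt.toZMod v
          - PadicInt.toZMod c * PadicInt.toZMod w)
        + PadicInt.toZMod (y 3) * (PadicInt.toZMod v * PadicInt.toZMod w
          - PadicInt.toZMod a * PadicInt.toZMod u)) = 0
      · have g3 := hgrad g0 g1 g2
        obtain ⟨t, ht, hr⟩ := PadicInt.exists_root_quadratic (a * b)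
          (y 0 * w + y 1 * (u * w - b * v) + y 2 * (v * w - a * u))
          (goodNorm a b c u v w (y 0) (y 1) (y 2) 0) (y 3)
          (by rw [← hN]; simp [goodNorm]; ring)
          (by
            intro h; apply g3; rw [← h]; simp [mul_assoc, h2])
        exact ⟨y 0, y 1, y 2, t, lift _ _ _ _ rfl rfl rfl hr,
          by rw [← ht]; unfold goodNorm; ring⟩
      · obtain ⟨t, ht, hr⟩ := PadicInt.exists_root_quadratic (a * c)
          (y 0 * v + y 1 * (u * v - c * w) + y 3 * (v * w - a * u))
          (goodNorm a b c u v w (y 0) (y 1) 0 (y 3)) (y 2)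
          (by rw [← hN]; simp [goodNorm]; ring)
          (by
            intro h; apply g2; rw [← h]; simp [mul_assoc, h2])
        exact ⟨y 0, y 1, t, y 3, lift _ _ _ _ rfl rfl hr rfl,
          by rw [← ht]; unfold goodNorm; ring⟩
    · obtain ⟨t, ht, hr⟩ := PadicInt.exists_root_quadratic (b * c)
        (y 0 * u + y 2 * (u * v - c * w) + y 3 * (u * w - b * v))
        (goodNorm a b c u v w (y 0) 0 (y 2) (y 3)) (y 1)
        (by rw [← hN]; simp [goodNorm]; ring)
        (by
          intro h; apply g1; rw [← h]; simp [mul_assoc, h2])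
      exact ⟨y 0, t, y 2, y 3, lift _ _ _ _ rfl hr rfl rfl,
        by rw [← ht]; unfold goodNorm; ring⟩
  · obtain ⟨t, ht, hr⟩ := PadicInt.exists_root_quadratic 1
      (y 1 * u + y 2 * v + y 3 * w)
      (goodNorm a b c u v w 0 (y 1) (y 2) (y 3)) (y 0)
      (by rw [← hN]; simp [goodNorm]; ring)
      (by
        intro h; apply g0; rw [← h]; simp [h2])
    exact ⟨t, y 1, y 2, y 3, lift _ _ _ _ hr rfl rfl rfl,
      by rw [← ht]; unfold goodNorm; ring⟩

section BaseChange

variable (K : Type*) [Field K] [CharZero K]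

/-- The inclusion of a rational quaternion algebra into its base change to `K`. -/
def baseChange : ℍ[ℚ, c₁, c₂] →+* ℍ[K, (c₁ : K), (c₂ : K)] where
  toFun x := ⟨x.re, x.imI, x.imJ, x.imK⟩
  map_one' := by ext <;> simp
  map_zero' := by ext <;> simp
  map_mul' x y := by ext <;> simp
  map_add' x y := by ext <;> simp

theorem baseChange_star (x : ℍ[ℚ, c₁, c₂]) : baseChange K (star x) = star (baseChange K x) := by
  ext <;> simp [baseChange]

theorem baseChange_smul (q : ℚ) (x : ℍ[ℚ, c₁, c₂]) :
    baseChange K (q • x) = (q : K) • baseChange K x := by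
  ext <;> simp [baseChange]

variable {K}

theorem IsGoodBasis.map {A B : Type*} [Ring A] [StarRing A] [Ring B] [StarRing B]
    {i j k : A} {a b c u v w : ℤ} (h : IsGoodBasis i j k a b c u v w) (f : A →+* B)
    (hf : ∀ x, f (star x) = star (f x)) : IsGoodBasis (f i) (f j) (f k) a b c u v w := by
  constructor
  · rw [← hf, h.star_i]; simp
  · rw [← hf, h.star_j]; simp
  · rw [← hf, h.star_k]; simp
  · rw [← map_mul, h.ii]; simp
  · rw [← map_mul, h.jj]; simp
  · rw [← map_mul, h.kk]; simp
  · rw [← map_mul, h.jk]; simp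
  · rw [← map_mul, h.ki]; simp
  · rw [← map_mul, h.ij]; simp
  · rw [← map_mul, h.kj]; simp
  · rw [← map_mul, h.ik]; simp
  · rw [← map_mul, h.ji]; simp

variable {i j k : ℍ[ℚ, c₁, c₂]} {a b c u v w : ℤ}

theorem IsGoodBasis.span_baseChange (h : IsGoodBasis i j k a b c u v w)
    (hs : Submodule.span ℚ (h.order : Set ℍ[ℚ, c₁, c₂]) = ⊤) :
    ⊤ ≤ Submodule.span K (Set.range
      ![1, baseChange K i, baseChange K j, baseChange K k]) := by
  have hrat : ∀ x : ℍ[ℚ, c₁, c₂], baseChange K x ∈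
      Submodule.span K (Set.range ![1, baseChange K i, baseChange K j, baseChange K k]) := by
    intro x
    have hx := h.span_eq_top hs (Submodule.mem_top (x := x))
    induction hx using Submodule.span_induction with
    | mem x hx =>
      obtain ⟨l, rfl⟩ := hx
      refine Submodule.subset_span ⟨l, ?_⟩
      fin_cases l <;> simp
    | zero => rw [map_zero]; exact zero_mem _
    | add x y _ _ hx hy => rw [map_add]; exact add_mem hx hy
    | smul q x _ hx => rw [baseChange_smul]; exact Submodule.smul_mem _ _ hx
  intro X _
  have : X = X.re • baseChange K 1 + X.imI • baseChange K (⟨0, 1, 0, 0⟩ : ℍ[ℚ, c₁, c₂])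
      + X.imJ • baseChange K (⟨0, 0, 1, 0⟩ : ℍ[ℚ, c₁, c₂])
      + X.imK • baseChange K (⟨0, 0, 0, 1⟩ : ℍ[ℚ, c₁, c₂]) := by
    ext <;> simp [baseChange]
  rw [this]
  exact add_mem (add_mem (add_mem (Submodule.smul_mem _ _ (hrat _))
    (Submodule.smul_mem _ _ (hrat _))) (Submodule.smul_mem _ _ (hrat _)))
    (Submodule.smul_mem _ _ (hrat _))

theorem IsGoodBasis.mul_star_self_baseChange (h : IsGoodBasis i j k a b c u v w) (n α β γ : K) :
    (n • 1 + α • baseChange K i + β • baseChange K j + γ • baseChange K k) *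
      star (n • 1 + α • baseChange K i + β • baseChange K j + γ • baseChange K k) =
      goodNorm (a : K) b c u v w n α β γ • 1 := by
  have h' := h.map (baseChange K) (baseChange_star K)
  rw [← h'.mul_star]
  simp only [star_add, QuaternionAlgebra.star_smul', star_one, h'.star_i, h'.star_j, h'.star_k]

theorem IsGoodBasis.isDivision_of_anisotropic (h : IsGoodBasis i j k a b c u v w)
    (hs : Submodule.span ℚ (h.order : Set ℍ[ℚ, c₁, c₂]) = ⊤)
    (an : ∀ x : Fin 4 → K, goodNorm (a : K) b c u v w (x 0) (x 1) (x 2) (x 3) = 0 → x = 0)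
    (X : ℍ[K, (c₁ : K), (c₂ : K)]) (hX : X ≠ 0) : ∃ Y, X * Y = 1 ∧ Y * X = 1 := by
  obtain ⟨x, hx⟩ := (Submodule.mem_span_range_iff_exists_fun K).1
    (h.span_baseChange (K := K) hs (Submodule.mem_top (x := X)))
  simp only [Fin.sum_univ_four, Matrix.cons_val] at hx
  have hN := h.mul_star_self_baseChange (x 0) (x 1) (x 2) (x 3)
  rw [hx] at hN
  have hr : goodNorm (a : K) b c u v w (x 0) (x 1) (x 2) (x 3) ≠ 0 := by
    intro h0
    apply hX
    rw [← hx, an x h0]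
    simp
  have hN' : star X * X = X * star X := star_comm_self' X
  refine ⟨(goodNorm (a : K) b c u v w (x 0) (x 1) (x 2) (x 3))⁻¹ • star X, ?_, ?_⟩
  · rw [mul_smul_comm, hN, inv_smul_smul₀ hr]
  · rw [smul_mul_assoc, hN', hN, inv_smul_smul₀ hr]

theorem IsGoodBasis.not_isDivision_of_isotropic (h : IsGoodBasis i j k a b c u v w)
    (hs : Submodule.span ℚ (h.order : Set ℍ[ℚ, c₁, c₂]) = ⊤) {n α β γ : K}
    (hne : ¬ (n = 0 ∧ α = 0 ∧ β = 0 ∧ γ = 0))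
    (hN : goodNorm (a : K) b c u v w n α β γ = 0) :
    ¬ ∀ X : ℍ[K, (c₁ : K), (c₂ : K)], X ≠ 0 → ∃ Y, X * Y = 1 ∧ Y * X = 1 := by
  intro hdiv
  have hli : LinearIndependent K ![1, baseChange K i, baseChange K j, baseChange K k] :=
    linearIndependent_of_top_le_span_of_card_eq_finrank (h.span_baseChange hs)
      (by rw [QuaternionAlgebra.finrank_eq_four, Fintype.card_fin])
  have hX : n • 1 + α • baseChange K i + β • baseChange K j + γ • baseChange K k ≠ 0 := by
    intro h0
    have := Fintype.linearIndependent_iff.1 hli ![n, α, β, γ] (by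
      simpa only [Fin.sum_univ_four, Matrix.cons_val] using h0)
    exact hne ⟨this 0, this 1, this 2, this 3⟩
  obtain ⟨Y, -, hY⟩ := hdiv _ hX
  have hXX := h.mul_star_self_baseChange n α β γ
  rw [hN, zero_smul] at hXX
  have h0 := congrArg (Y * ·) hXX
  simp only [← mul_assoc, hY, one_mul, mul_zero, star_eq_zero] at h0
  exact hX h0

end BaseChange

theorem IsCliffordOrder.natAbs_halfDisc {p : ℕ} [hp : Fact p.Prime]
    (hram : RamifiedExactlyAt p c₁ c₂) {O : Subalgebra ℤ ℍ[ℚ, c₁, c₂]} (hO : IsMaximalOrder O)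
    {a b c u v w : ℤ} (h : IsCliffordOrder O a b c u v w) :
    (halfDisc a b c u v w).natAbs = p := by
  have hsq : ∀ ℓ : ℕ, ℓ.Prime → ¬ ℓ * ℓ ∣ (halfDisc a b c u v w).natAbs := by
    intro ℓ hℓ hd
    have : Fact ℓ.Prime := ⟨hℓ⟩
    apply h.not_sq_dvd_halfDisc hO (ℓ := ℓ)
    rw [← Int.natCast_dvd] at hd
    rw [sq]; exact_mod_cast hd
  have honly : ∀ ℓ : ℕ, ℓ.Prime → ℓ ∣ (halfDisc a b c u v w).natAbs → ℓ = p := by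
    intro ℓ hℓ hd
    have : Fact ℓ.Prime := ⟨hℓ⟩
    by_contra hne
    obtain ⟨a, b, c, u, v, w, h', -, hc, hu, hv⟩ :=
      h.exists_degenerate (Int.natCast_dvd.2 hd)
    refine hram.2.2 ℓ hne ?_
    have an := h'.eq_zero_of_goodNorm_eq_zero hO hc hu hv
    obtain ⟨i, j, k, h', rfl⟩ := h'
    exact h'.isDivision_of_anisotropic hO.1.2 an
  have hdvd : p ∣ (halfDisc a b c u v w).natAbs := by
    by_contra hd
    obtain ⟨i, j, k, h', rfl⟩ := h
    obtain ⟨n, α, β, γ, hne, hN⟩ := exists_goodNorm_eq_zero_padic (p := p) (a : ℤ_[p]) b c u v w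
      (by
        rw [← PadicInt.toZMod_eq_zero_iff_dvd]
        intro h0
        apply hd
        rw [← Int.natCast_dvd, ← ZMod.intCast_zmod_eq_zero_iff_dvd, ← h0,
          ← map_intCast (PadicInt.toZMod (p := p))]
        congr 1
        simp [halfDisc])
    refine h'.not_isDivision_of_isotropic (K := ℚ_[p]) hO.1.2 (n := n) (α := α) (β := β) (γ := γ)
      ?_ ?_ hram.2.1
    · simpa only [PadicInt.coe_eq_zero] using hne
    · have := congrArg (fun x : ℤ_[p] => (x : ℚ_[p])) hN
      simpa [goodNorm] using this
  have hsf : Squarefree (halfDisc a b c u v w).natAbs := Nat.squarefree_iff_prime_squarefree.2 hsq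
  obtain ⟨m, hm⟩ := hdvd
  rw [hm]
  by_cases hm1 : m = 1
  · rw [hm1, mul_one]
  · exfalso
    obtain ⟨q, hq, hqm⟩ := Nat.exists_prime_and_dvd hm1
    obtain rfl := honly q hq (hm ▸ Dvd.dvd.mul_left hqm p)
    exact hsq q hq (hm ▸ mul_dvd_mul_left q hqm)

theorem neg_of_ramified {p : ℕ} [Fact p.Prime] (hram : RamifiedExactlyAt p c₁ c₂) : c₁ < 0 ∧ c₂ < 0 := by
  constructor
  · by_contra! h
    have hr : (0 : ℝ) ≤ c₁ := by exact_mod_cast h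
    obtain ⟨y, -, hy⟩ := hram.1 ⟨√c₁, 1, 0, 0⟩ (fun h => by
      have := congrArg QuaternionAlgebra.imI h; simp at this)
    have hz : (⟨√c₁, 1, 0, 0⟩ * ⟨-√c₁, 1, 0, 0⟩ : ℍ[ℝ, (c₁ : ℝ), (c₂ : ℝ)]) = 0 := by
      ext <;> simp [Real.mul_self_sqrt hr]
    have h0 := congrArg (y * ·) hz
    simp only [← mul_assoc, hy, one_mul, mul_zero] at h0
    have := congrArg QuaternionAlgebra.imI h0
    simp at this
  · by_contra! h
    have hr : (0 : ℝ) ≤ c₂ := by exact_mod_cast h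
    obtain ⟨y, -, hy⟩ := hram.1 ⟨√c₂, 0, 1, 0⟩ (fun h => by
      have := congrArg QuaternionAlgebra.imJ h; simp at this)
    have hz : (⟨√c₂, 0, 1, 0⟩ * ⟨-√c₂, 0, 1, 0⟩ : ℍ[ℝ, (c₁ : ℝ), (c₂ : ℝ)]) = 0 := by
      ext <;> simp [Real.mul_self_sqrt hr]
    have h0 := congrArg (y * ·) hz
    simp only [← mul_assoc, hy, one_mul, mul_zero] at h0
    have := congrArg QuaternionAlgebra.imJ h0
    simp at this

theorem Nr_eq (x : ℍ[ℚ, c₁, c₂]) : Nr x =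
    x.re ^ 2 - c₁ * x.imI ^ 2 - c₂ * x.imJ ^ 2 + c₁ * c₂ * x.imK ^ 2 := by
  simp [Nr]; ring

theorem mul_star_self (x : ℍ[ℚ, c₁, c₂]) : x * star x = Nr x • 1 := by
  ext <;> simp [Nr] <;> ring

theorem star_mul_self_eq (x : ℍ[ℚ, c₁, c₂]) : star x * x = Nr x • 1 := by
  ext <;> simp [Nr] <;> ring

theorem Nr_mul (x y : ℍ[ℚ, c₁, c₂]) : Nr (x * y) = Nr x * Nr y := by
  simp [Nr]; ring

theorem Nr_one : Nr (1 : ℍ[ℚ, c₁, c₂]) = 1 := by simp [Nr]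

theorem Nr_pow (x : ℍ[ℚ, c₁, c₂]) (n : ℕ) : Nr (x ^ n) = Nr x ^ n := by
  induction n with
  | zero => simp [Nr_one]
  | succ n ih => rw [pow_succ, Nr_mul, ih, pow_succ]

theorem Nr_smul (q : ℚ) (x : ℍ[ℚ, c₁, c₂]) : Nr (q • x) = q ^ 2 * Nr x := by
  simp [Nr]; ring

theorem exists_int_of_pow_denominator_bounded {q : ℚ} {M : ℤ} (hM : M ≠ 0)
    (h : ∀ n : ℕ, ∃ m : ℤ, M * q ^ n = m) : ∃ m : ℤ, q = m := by
  have hden : ∀ n : ℕ, q.den ^ n ∣ M.natAbs := by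
    intro n
    obtain ⟨m, hm⟩ := h n
    have hM' : (M : ℚ) ≠ 0 := by exact_mod_cast hM
    have : q ^ n = Rat.divInt m M := by
      rw [Rat.divInt_eq_div, eq_div_iff hM', mul_comm, hm]
    rw [← Rat.den_pow, this, ← Int.natCast_dvd]
    exact Rat.den_dvd m M
  have h1 : q.den = 1 := by
    by_contra hne
    have h2 : 2 ≤ q.den := by have := q.den_pos; omega
    have hle := Nat.le_of_dvd (Int.natAbs_pos.2 hM) (hden M.natAbs)
    have := (Nat.lt_pow_self (n := M.natAbs) (a := q.den) h2)
    omega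
  exact ⟨q.num, (Rat.coe_int_num_of_den_eq_one h1).symm⟩

theorem exists_common_denominator {L : Submodule ℤ ℍ[ℚ, c₁, c₂]} (hL : L.FG) :
    ∃ N : ℤ, N ≠ 0 ∧ ∀ x ∈ L, ∃ a b c d : ℤ, N * x.re = a ∧ N * x.imI = b ∧
      N * x.imJ = c ∧ N * x.imK = d := by
  induction L, hL using Submodule.fg_induction with
  | singleton x =>
    refine ⟨x.re.den * x.imI.den * x.imJ.den * x.imK.den,
      by simp [Rat.den_ne_zero], fun y hy => ?_⟩
    obtain ⟨m, rfl⟩ := Submodule.mem_span_singleton.1 hy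
    have e : ∀ q : ℚ, (q.den : ℚ) * q = q.num := fun q => Rat.den_mul_eq_num q
    refine ⟨m * x.re.num * x.imI.den * x.imJ.den * x.imK.den,
      m * x.re.den * x.imI.num * x.imJ.den * x.imK.den,
      m * x.re.den * x.imI.den * x.imJ.num * x.imK.den,
      m * x.re.den * x.imI.den * x.imJ.den * x.imK.num, ?_, ?_, ?_, ?_⟩ <;>
    · rw [← Int.cast_smul_eq_zsmul ℚ]
      push_cast
      simp only [QuaternionAlgebra.re_smul, QuaternionAlgebra.imI_smul,
        QuaternionAlgebra.imJ_smul, QuaternionAlgebra.imK_smul, smul_eq_mul]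
      simp only [← e]
      ring
  | sup L₁ L₂ h₁ h₂ ih₁ ih₂ =>
    obtain ⟨N₁, hN₁, H₁⟩ := ih₁
    obtain ⟨N₂, hN₂, H₂⟩ := ih₂
    refine ⟨N₁ * N₂, mul_ne_zero hN₁ hN₂, fun x hx => ?_⟩
    obtain ⟨y, hy, z, hz, rfl⟩ := Submodule.mem_sup.1 hx
    obtain ⟨a, b, c, d, ha, hb, hc, hd⟩ := H₁ y hy
    obtain ⟨a', b', c', d', ha', hb', hc', hd'⟩ := H₂ z hz
    refine ⟨N₂ * a + N₁ * a', N₂ * b + N₁ * b', N₂ * c + N₁ * c', N₂ * d + N₁ * d', ?_, ?_, ?_, ?_⟩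
    · push_cast; rw [← ha, ← ha']; simp; ring
    · push_cast; rw [← hb, ← hb']; simp; ring
    · push_cast; rw [← hc, ← hc']; simp; ring
    · push_cast; rw [← hd, ← hd']; simp; ring

namespace IsOrder

variable {O : Subalgebra ℤ ℍ[ℚ, c₁, c₂]}

theorem exists_int_Nr (hO : IsOrder O) {x : ℍ[ℚ, c₁, c₂]} (hx : x ∈ O) : ∃ m : ℤ, Nr x = m := by
  obtain ⟨N, hN, H⟩ := exists_common_denominator hO.1
  refine exists_int_of_pow_denominator_bounded (M := N ^ 2 * (c₁.den * c₂.den))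
    (by simp [hN, Rat.den_ne_zero]) fun n => ?_
  obtain ⟨a, b, c, d, ha, hb, hc, hd⟩ := H (x ^ n) (pow_mem hx n)
  refine ⟨c₁.den * c₂.den * a ^ 2 - c₁.num * c₂.den * b ^ 2 - c₁.den * c₂.num * c ^ 2
    + c₁.num * c₂.num * d ^ 2, ?_⟩
  rw [← Nr_pow, Nr_eq]
  push_cast
  rw [← ha, ← hb, ← hc, ← hd, ← Rat.den_mul_eq_num c₁, ← Rat.den_mul_eq_num c₂]
  ring

theorem exists_int_trace (hO : IsOrder O) {x : ℍ[ℚ, c₁, c₂]} (hx : x ∈ O) :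
    ∃ m : ℤ, 2 * x.re = m := by
  obtain ⟨m, hm⟩ := hO.exists_int_Nr hx
  obtain ⟨m', hm'⟩ := hO.exists_int_Nr (add_mem (one_mem O) hx)
  refine ⟨m' - 1 - m, ?_⟩
  push_cast
  rw [← hm, ← hm', Nr_eq, Nr_eq]
  simp
  ring

end IsOrder

theorem exists_int_of_root {q : ℚ} {t n : ℤ} (h : q ^ 2 + t * q + n = 0) : ∃ m : ℤ, q = m := by
  have : IsIntegral ℤ q :=
    ⟨X ^ 2 + C t * X + C n, by monicity!, by
      simpa only [eval₂_add, eval₂_mul, eval₂_pow, eval₂_X, eval₂_C, algebraMap_int_eq,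
        Int.coe_castRingHom] using h⟩
  obtain ⟨m, hm⟩ := IsIntegrallyClosed.isIntegral_iff.1 this
  exact ⟨m, by rw [← hm]; simp⟩

theorem IsGoodBasis.of_star {A : Type*} [Ring A] [StarRing A] {i j k : A} {a b c u v w : ℤ}
    (hi : star i = u • 1 - i) (hj : star j = v • 1 - j) (hk : star k = w • 1 - k)
    (hii : i * star i = (b * c) • 1) (hjj : j * star j = (a * c) • 1)
    (hkk : k * star k = (a * b) • 1)
    (hjk : j * k = a • star i) (hki : k * i = b • star j) (hij : i * j = c • star k) :
    IsGoodBasis i j k a b c u v w := by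
  have hkj := congrArg star hjk
  have hik := congrArg star hki
  have hji := congrArg star hij
  simp only [star_mul, star_zsmul, star_star] at hkj hik hji
  rw [hi] at hii hjk
  rw [hj] at hjj hki
  rw [hk] at hkk hij
  rw [hk, hj] at hkj
  rw [hi, hk] at hik
  rw [hj, hi] at hji
  simp only [mul_sub, sub_mul, mul_smul_comm, smul_mul_assoc, mul_one, one_mul] at *
  refine ⟨hi, hj, hk, ?_, ?_, ?_, ?_, ?_, ?_, ?_, ?_, ?_⟩
  · rw [← hii]; abel
  · rw [← hjj]; abel
  · rw [← hkk]; abel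
  · rw [hjk]; module
  · rw [hki]; module
  · rw [hij]; module
  · rw [← hkj]; module
  · rw [← hik]; module
  · rw [← hji]; module

theorem IsGoodBasis.of_pure {e₁ e₂ e₃ : ℍ[ℚ, c₁, c₂]} {δ : ℚ} (hδ : δ ≠ 0) {a b c u v w : ℤ}
    (s₁ : star e₁ = -e₁) (s₂ : star e₂ = -e₂) (s₃ : star e₃ = -e₃)
    (h₁ : e₁ * e₁ = (δ * a) • 1) (h₂ : e₂ * e₂ = (δ * b) • 1) (h₃ : e₃ * e₃ = (δ * c) • 1)
    (h₂₃ : e₂ * e₃ + e₃ * e₂ = (δ * u) • 1) (h₃₁ : e₃ * e₁ + e₁ * e₃ = (δ * v) • 1)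
    (h₁₂ : e₁ * e₂ + e₂ * e₁ = (δ * w) • 1) :
    IsGoodBasis (δ⁻¹ • (e₂ * e₃)) (δ⁻¹ • (e₃ * e₁)) (δ⁻¹ • (e₁ * e₂)) a b c u v w := by
  have st : ∀ {x y : ℍ[ℚ, c₁, c₂]}, star x = -x → star y = -y →
      star (δ⁻¹ • (x * y)) = δ⁻¹ • (y * x) := by
    intro x y hx hy
    rw [QuaternionAlgebra.star_smul', star_mul, hx, hy, neg_mul_neg]
  have tr : ∀ {x y : ℍ[ℚ, c₁, c₂]} {t : ℤ}, x * y + y * x = (δ * t) • 1 →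
      δ⁻¹ • (y * x) = t • (1 : ℍ[ℚ, c₁, c₂]) - δ⁻¹ • (x * y) := by
    intro x y t h
    rw [← eq_sub_iff_add_eq'] at h
    rw [h, smul_sub, smul_smul, inv_mul_cancel_left₀ hδ, Int.cast_smul_eq_zsmul]
  have pr : ∀ {x y z : ℍ[ℚ, c₁, c₂]} {t : ℤ}, y * y = (δ * t) • 1 →
      (δ⁻¹ • (x * y)) * (δ⁻¹ • (y * z)) = t • (δ⁻¹ • (x * z)) := by
    intro x y z t h
    rw [smul_mul_smul_comm, mul_assoc, ← mul_assoc y, h, smul_mul_assoc, one_mul, mul_smul_comm,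
      smul_smul, ← Int.cast_smul_eq_zsmul ℚ, smul_smul]
    congr 1
    field_simp
  have nm : ∀ {x y : ℍ[ℚ, c₁, c₂]} {s t : ℤ}, x * x = (δ * s) • 1 → y * y = (δ * t) • 1 →
      (δ⁻¹ • (x * y)) * (δ⁻¹ • (y * x)) = (s * t) • 1 := by
    intro x y s t hx hy
    rw [pr hy, hx, smul_smul, inv_mul_cancel_left₀ hδ, Int.cast_smul_eq_zsmul, smul_smul, mul_comm]
  apply IsGoodBasis.of_star
  · rw [st s₂ s₃, tr h₂₃]
  · rw [st s₃ s₁, tr h₃₁]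
  · rw [st s₁ s₂, tr h₁₂]
  · rw [st s₂ s₃, nm h₂ h₃]
  · rw [st s₃ s₁, nm h₃ h₁, mul_comm c a]
  · rw [st s₁ s₂, nm h₁ h₂]
  · rw [st s₂ s₃, pr h₁]
  · rw [st s₃ s₁, pr h₂]
  · rw [st s₁ s₂, pr h₃]

/-- The volume form on pure parts: twice the real part of `[x, y] z̄`. -/
def tripleProduct (x y z : ℍ[ℚ, c₁, c₂]) : ℚ := 2 * ((x * y - y * x) * star z).re

theorem tripleProduct_cycle (x y z : ℍ[ℚ, c₁, c₂]) :
    tripleProduct y z x = tripleProduct x y z := by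
  simp [tripleProduct]; ring

theorem exists_tripleProduct_ne_zero_of_linearIndependent (hc₁ : c₁ ≠ 0) (hc₂ : c₂ ≠ 0)
    {a₁ a₂ a₃ : ℍ[ℚ, c₁, c₂]} (h : LinearIndependent ℚ ![1, a₁, a₂, a₃]) :
    tripleProduct a₁ a₂ a₃ ≠ 0 := by
  intro h0
  have hdet : tripleProduct a₁ a₂ a₃ = 4 * c₁ * c₂ * (!![a₁.imI, a₂.imI, a₃.imI;
      a₁.imJ, a₂.imJ, a₃.imJ; a₁.imK, a₂.imK, a₃.imK]).det := by
    rw [Matrix.det_fin_three]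
    simp [tripleProduct]
    ring
  rw [h0, eq_comm, mul_eq_zero, or_iff_right (by simp [hc₁, hc₂])] at hdet
  obtain ⟨x, hx, hM⟩ := Matrix.exists_mulVec_eq_zero_iff.2 hdet
  have e0 := congrFun hM 0
  have e1 := congrFun hM 1
  have e2 := congrFun hM 2
  simp only [Matrix.mulVec, dotProduct, Fin.sum_univ_three, Matrix.of_apply,
    Matrix.cons_val, Pi.zero_apply] at e0 e1 e2
  have := Fintype.linearIndependent_iff.1 h
    ![-(x 0 * a₁.re + x 1 * a₂.re + x 2 * a₃.re), x 0, x 1, x 2] (by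
      simp only [Fin.sum_univ_four, Matrix.cons_val]
      ext
      · simp; ring
      · simp; linear_combination e0
      · simp; linear_combination e1
      · simp; linear_combination e2)
  apply hx
  ext l
  fin_cases l
  · exact this 1
  · exact this 2
  · exact this 3

theorem exists_int_re_commutator_mul {x y z : ℍ[ℚ, c₁, c₂]} {t : ℍ[ℚ, c₁, c₂]}
    (ht : ∃ n α β γ : ℤ, t = n • (1 : ℍ[ℚ, c₁, c₂]) + α • x + β • y + γ • z) :
    ∃ m : ℤ, 2 * ((x * y - y * x) * t).re = tripleProduct x y z * m := by
  obtain ⟨n, α, β, γ, rfl⟩ := ht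
  refine ⟨-γ, ?_⟩
  simp only [← Int.cast_smul_eq_zsmul ℚ]
  simp [tripleProduct]
  ring

theorem commutator_mul_self (x y : ℍ[ℚ, c₁, c₂]) :
    (x * y - y * x) * (x * y - y * x) = (2 * ((x * y - y * x) * (x * y)).re) • 1 := by
  ext <;> simp <;> ring

theorem commutator_add (x y z t : ℍ[ℚ, c₁, c₂]) :
    (x * y - y * x) * (z * t - t * z) + (z * t - t * z) * (x * y - y * x) =
      (2 * ((x * y - y * x) * (z * t - t * z)).re) • 1 := by
  ext <;> simp <;> ring

theorem commutator_mul_commutator (x y z : ℍ[ℚ, c₁, c₂]) : ∃ q : ℚ,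
    (z * x - x * z) * (x * y - y * x) = tripleProduct x y z • x + q • 1 := by
  refine ⟨((z * x - x * z) * (x * y - y * x)).re - tripleProduct x y z * x.re, ?_⟩
  ext <;> simp [tripleProduct] <;> ring

theorem exists_int_shift {O : Subalgebra ℤ ℍ[ℚ, c₁, c₂]} (hO : IsOrder O) {x y : ℍ[ℚ, c₁, c₂]}
    (hx : x ∈ O) {q : ℚ} (h : y = x + q • 1) {m : ℤ} (hm : y * star y = m • 1) :
    ∃ t : ℤ, y = x + t • 1 := by
  obtain ⟨n, hn⟩ := hO.exists_int_Nr hx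
  obtain ⟨t, ht⟩ := hO.exists_int_trace hx
  obtain ⟨s, hs⟩ := exists_int_of_root (q := q) (t := t) (n := n - m) (by
    have e := congrArg QuaternionAlgebra.re hm
    rw [← Int.cast_smul_eq_zsmul ℚ] at e
    push_cast
    rw [← hn, ← ht, Nr_eq]
    rw [h] at e
    simp at e
    linear_combination e)
  exact ⟨s, by rw [h, hs, Int.cast_smul_eq_zsmul]⟩

theorem IsOrder.exists_isGoodBasis {O : Subalgebra ℤ ℍ[ℚ, c₁, c₂]} (hO : IsOrder O)
    (hc₁ : c₁ ≠ 0) (hc₂ : c₂ ≠ 0) {x y z : ℍ[ℚ, c₁, c₂]} (hx : x ∈ O) (hy : y ∈ O) (hz : z ∈ O)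
    (hgen : ∀ s ∈ O, ∃ n α β γ : ℤ, s = n • (1 : ℍ[ℚ, c₁, c₂]) + α • x + β • y + γ • z) :
    ∃ (a b c u v w q r s : ℤ) (h : IsGoodBasis (x + q • 1) (y + r • 1) (z + s • 1) a b c u v w),
      h.order = O := by
  have hspan : ⊤ ≤ Submodule.span ℚ (Set.range ![1, x, y, z]) := by
    rw [← hO.2, Submodule.span_le]
    intro s hs
    obtain ⟨n, α, β, γ, rfl⟩ := hgen s hs
    have key : ∀ l : Fin 4, ![1, x, y, z] l ∈ Submodule.span ℚ (Set.range ![1, x, y, z]) :=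
      fun l => Submodule.subset_span ⟨l, rfl⟩
    simp only [← Int.cast_smul_eq_zsmul ℚ]
    exact Submodule.add_mem _ (Submodule.add_mem _ (Submodule.add_mem _
      (Submodule.smul_mem _ _ (key 0)) (Submodule.smul_mem _ _ (key 1)))
      (Submodule.smul_mem _ _ (key 2))) (Submodule.smul_mem _ _ (key 3))
  have hδ := exists_tripleProduct_ne_zero_of_linearIndependent hc₁ hc₂
    (linearIndependent_of_top_le_span_of_card_eq_finrank hspan
      (by rw [QuaternionAlgebra.finrank_eq_four, Fintype.card_fin]))
  have hstar : ∀ x y : ℍ[ℚ, c₁, c₂], star (x * y - y * x) = -(x * y - y * x) := by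
    intro x y; ext <;> simp <;> ring
  have hcyc : tripleProduct y z x = tripleProduct x y z := tripleProduct_cycle x y z
  have hcyc' : tripleProduct z x y = tripleProduct x y z := (tripleProduct_cycle y z x).trans hcyc
  have h₁ : ∀ s ∈ O, ∃ m : ℤ, 2 * ((y * z - z * y) * s).re = tripleProduct x y z * m :=
    fun s hs => hcyc ▸ exists_int_re_commutator_mul (by
      obtain ⟨n, α, β, γ, rfl⟩ := hgen s hs
      exact ⟨n, β, γ, α, by abel⟩)
  have h₂ : ∀ s ∈ O, ∃ m : ℤ, 2 * ((z * x - x * z) * s).re = tripleProduct x y z * m :=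
    fun s hs => hcyc' ▸ exists_int_re_commutator_mul (by
      obtain ⟨n, α, β, γ, rfl⟩ := hgen s hs
      exact ⟨n, γ, α, β, by abel⟩)
  have h₃ : ∀ s ∈ O, ∃ m : ℤ, 2 * ((x * y - y * x) * s).re = tripleProduct x y z * m :=
    fun s hs => exists_int_re_commutator_mul (hgen s hs)
  have m₁ : y * z - z * y ∈ O := sub_mem (mul_mem hy hz) (mul_mem hz hy)
  have m₂ : z * x - x * z ∈ O := sub_mem (mul_mem hz hx) (mul_mem hx hz)
  have m₃ : x * y - y * x ∈ O := sub_mem (mul_mem hx hy) (mul_mem hy hx)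
  obtain ⟨a, ha⟩ := h₁ _ (mul_mem hy hz)
  obtain ⟨b, hb⟩ := h₂ _ (mul_mem hz hx)
  obtain ⟨c, hc⟩ := h₃ _ (mul_mem hx hy)
  obtain ⟨u, hu⟩ := h₂ _ m₃
  obtain ⟨v, hv⟩ := h₃ _ m₁
  obtain ⟨w, hw⟩ := h₁ _ m₂
  have h := IsGoodBasis.of_pure hδ (hstar y z) (hstar z x) (hstar x y)
    (by rw [commutator_mul_self, ha]) (by rw [commutator_mul_self, hb])
    (by rw [commutator_mul_self, hc]) (by rw [commutator_add, hu]) (by rw [commutator_add, hv])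
    (by rw [commutator_add, hw])
  have mul_star : ∀ {t : ℍ[ℚ, c₁, c₂]} {u m : ℤ}, star t = u • 1 - t →
      t * t = u • t - m • 1 → t * star t = m • 1 := by
    intro t u m h1 h2
    rw [h1, mul_sub, h2, mul_smul_comm, mul_one]
    abel
  have scale : ∀ {s t : ℍ[ℚ, c₁, c₂]}, (∃ q : ℚ, t = tripleProduct x y z • s + q • 1) →
      ∃ q : ℚ, (tripleProduct x y z)⁻¹ • t = s + q • 1 := by
    rintro s t ⟨q, rfl⟩
    exact ⟨(tripleProduct x y z)⁻¹ * q, by rw [smul_add, inv_smul_smul₀ hδ, smul_smul]⟩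
  obtain ⟨q', hq'⟩ := scale (commutator_mul_commutator x y z)
  obtain ⟨r', hr'⟩ := scale (hcyc ▸ commutator_mul_commutator y z x)
  obtain ⟨s', hs'⟩ := scale (hcyc' ▸ commutator_mul_commutator z x y)
  obtain ⟨q, hq⟩ := exists_int_shift hO hx hq' (mul_star h.star_i h.ii)
  obtain ⟨r, hr⟩ := exists_int_shift hO hy hr' (mul_star h.star_j h.jj)
  obtain ⟨s, hs⟩ := exists_int_shift hO hz hs' (mul_star h.star_k h.kk)
  rw [hq, hr, hs] at h
  refine ⟨a, b, c, u, v, w, q, r, s, h, ?_⟩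
  apply le_antisymm
  · rintro _ ⟨n, α, β, γ, rfl⟩
    have hz1 : ∀ m : ℤ, m • (1 : ℍ[ℚ, c₁, c₂]) ∈ O := fun m => zsmul_mem (one_mem O) m
    exact add_mem (add_mem (add_mem (hz1 n) (zsmul_mem (add_mem hx (hz1 q)) α))
      (zsmul_mem (add_mem hy (hz1 r)) β)) (zsmul_mem (add_mem hz (hz1 s)) γ)
  · intro t ht
    obtain ⟨n, α, β, γ, rfl⟩ := hgen t ht
    exact ⟨n - α * q - β * r - γ * s, α, β, γ, by module⟩

/-- The bilinear form with `bil x x = Nr x`. -/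
def bil (x y : ℍ[ℚ, c₁, c₂]) : ℚ := (x * star y).re

theorem Nr_smul_add (x y : ℍ[ℚ, c₁, c₂]) (α β : ℚ) :
    Nr (α • x + β • y) = α ^ 2 * Nr x + β ^ 2 * Nr y + 2 * α * β * bil x y := by
  simp [Nr, bil]; ring

theorem Nr_smul_add_add (x y z : ℍ[ℚ, c₁, c₂]) (α β γ : ℚ) :
    Nr (α • x + β • y + γ • z) = α ^ 2 * Nr x + β ^ 2 * Nr y + γ ^ 2 * Nr z
      + 2 * α * β * bil x y + 2 * α * γ * bil x z + 2 * β * γ * bil y z := by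
  simp [Nr, bil]; ring

theorem Nr_zero : Nr (0 : ℍ[ℚ, c₁, c₂]) = 0 := by simp [Nr]

theorem Nr_nonneg (h₁ : c₁ < 0) (h₂ : c₂ < 0) (x : ℍ[ℚ, c₁, c₂]) : 0 ≤ Nr x := by
  rw [Nr_eq]
  nlinarith [sq_nonneg x.re, mul_nonneg (neg_pos.2 h₁).le (sq_nonneg x.imI),
    mul_nonneg (neg_pos.2 h₂).le (sq_nonneg x.imJ),
    mul_nonneg (mul_pos_of_neg_of_neg h₁ h₂).le (sq_nonneg x.imK)]

theorem Nr_pos (h₁ : c₁ < 0) (h₂ : c₂ < 0) {x : ℍ[ℚ, c₁, c₂]} (hx : x ≠ 0) : 0 < Nr x := by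
  refine (Nr_nonneg h₁ h₂ x).lt_of_ne' fun h => hx ?_
  rw [Nr_eq] at h
  have e₀ := sq_nonneg x.re
  have e₁ := mul_nonneg (neg_pos.2 h₁).le (sq_nonneg x.imI)
  have e₂ := mul_nonneg (neg_pos.2 h₂).le (sq_nonneg x.imJ)
  have e₃ := mul_nonneg (mul_pos_of_neg_of_neg h₁ h₂).le (sq_nonneg x.imK)
  have f₀ : x.re ^ 2 = 0 := by linarith
  have f₁ : -c₁ * x.imI ^ 2 = 0 := by linarith
  have f₂ : -c₂ * x.imJ ^ 2 = 0 := by linarith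
  have f₃ : c₁ * c₂ * x.imK ^ 2 = 0 := by linarith
  simp [h₁.ne, h₂.ne] at f₀ f₁ f₂ f₃
  ext <;> simp [*]

theorem grossMap_eq (x : ℍ[ℚ, c₁, c₂]) : grossMap x = x - star x := by
  change 2 • x - (x + star x) = _
  rw [two_smul]; abel

theorem grossMap_re (x : ℍ[ℚ, c₁, c₂]) : (grossMap x).re = 0 := by
  simp [grossMap_eq]

namespace IsOrder
variable {O : Subalgebra ℤ ℍ[ℚ, c₁, c₂]}

theorem exists_int_Nr_grossLattice (hO : IsOrder O) {g : ℍ[ℚ, c₁, c₂]} (hg : g ∈ GrossLattice O) :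
    ∃ n t : ℤ, Nr g = ((4 * n - t ^ 2 : ℤ) : ℚ) := by
  obtain ⟨x, hx, rfl⟩ := hg
  obtain ⟨n, hn⟩ := hO.exists_int_Nr hx
  obtain ⟨t, ht⟩ := hO.exists_int_trace hx
  refine ⟨n, t, ?_⟩
  push_cast
  rw [← hn, ← ht, Nr_eq, Nr_eq, grossMap_eq]
  simp; ring

theorem three_le_Nr_grossLattice (hO : IsOrder O) (h₁ : c₁ < 0) (h₂ : c₂ < 0)
    {g : ℍ[ℚ, c₁, c₂]} (hg : g ∈ GrossLattice O) (h0 : g ≠ 0) : 3 ≤ Nr g := by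
  obtain ⟨n, t, h⟩ := hO.exists_int_Nr_grossLattice hg
  have hpos := Nr_pos h₁ h₂ h0
  rw [h] at hpos ⊢
  have : (0 : ℤ) < 4 * n - t ^ 2 := by exact_mod_cast hpos
  have : (3 : ℤ) ≤ 4 * n - t ^ 2 := by
    rcases Int.even_or_odd t with ⟨s, rfl⟩ | ⟨s, rfl⟩ <;> ring_nf at this ⊢ <;> omega
  exact_mod_cast this

theorem exists_mem_grossLattice_notMem (hO : IsOrder O) (x y : ℍ[ℚ, c₁, c₂]) :
    ∃ g ∈ GrossLattice O, ∀ α β : ℚ, g ≠ α • x + β • y := by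
  by_contra! H
  have hspan : ⊤ ≤ Submodule.span ℚ (Set.range ![1, x, y]) := by
    rw [← hO.2, Submodule.span_le]
    intro s hs
    obtain ⟨α, β, h⟩ := H _ ⟨s, hs, rfl⟩
    have key : ∀ l : Fin 3, ![1, x, y] l ∈ Submodule.span ℚ (Set.range ![1, x, y]) :=
      fun l => Submodule.subset_span ⟨l, rfl⟩
    have : s = s.re • 1 + (α / 2) • x + (β / 2) • y := by
      have : s = s.re • 1 + (1 / 2 : ℚ) • grossMap s := by
        rw [grossMap_eq]; ext <;> simp <;> ring
      rw [h] at this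
      rw [add_assoc]
      convert this using 2
      module
    rw [SetLike.mem_coe, this]
    exact Submodule.add_mem _ (Submodule.add_mem _ (Submodule.smul_mem _ _ (key 0))
      (Submodule.smul_mem _ _ (key 1))) (Submodule.smul_mem _ _ (key 2))
  have h4 := QuaternionAlgebra.finrank_eq_four c₁ (0 : ℚ) c₂
  have := finrank_range_le_card (R := ℚ) ![1, x, y]
  rw [Set.finrank, top_le_iff.1 hspan, finrank_top, h4] at this
  simp at this

theorem finite_grossLattice (hO : IsOrder O) (h₁ : c₁ < 0) (h₂ : c₂ < 0) (n : ℕ) :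
    {h | h ∈ GrossLattice O ∧ Nr h = n}.Finite := by
  obtain ⟨N, hN, H⟩ := exists_common_denominator (hO.1.map grossMap)
  obtain ⟨M, hM⟩ := exists_int_gt ((N : ℚ) ^ 2 * n * ((-c₁)⁻¹ + (-c₂)⁻¹ + (c₁ * c₂)⁻¹))
  have hc := mul_pos_of_neg_of_neg h₁ h₂
  have p₁ : 0 < (-c₁)⁻¹ := inv_pos.2 (neg_pos.2 h₁)
  have p₂ : 0 < (-c₂)⁻¹ := inv_pos.2 (neg_pos.2 h₂)
  have p₃ : 0 < (c₁ * c₂)⁻¹ := inv_pos.2 hc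
  refine ((((Set.finite_Icc (-M) M).prod ((Set.finite_Icc (-M) M).prod
    (Set.finite_Icc (-M) M)))).image fun t : ℤ × ℤ × ℤ =>
      (⟨0, t.1 / N, t.2.1 / N, t.2.2 / N⟩ : ℍ[ℚ, c₁, c₂])).subset ?_
  rintro g ⟨hg, hn⟩
  obtain ⟨-, a, b, c, -, ha, hb, hc'⟩ := H g hg
  have hre : g.re = 0 := by
    obtain ⟨x, -, rfl⟩ := hg
    exact grossMap_re x
  have hN' : (N : ℚ) ≠ 0 := by exact_mod_cast hN
  have bound : ∀ {c y : ℚ} {a : ℤ}, 0 < c → N * y = a → c * y ^ 2 ≤ n →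
      (N : ℚ) ^ 2 * n * c⁻¹ < M → a ∈ Set.Icc (-M) M := by
    intro c y a hc ha hle hlt
    have h1 : (a : ℚ) ^ 2 ≤ N ^ 2 * n * c⁻¹ := by
      rw [← ha, mul_pow, mul_assoc]
      gcongr
      rw [← div_eq_mul_inv, le_div_iff₀ hc]
      linarith
    have h2 : a ^ 2 < M := by exact_mod_cast h1.trans_lt hlt
    exact ⟨by nlinarith, by nlinarith⟩
  rw [Nr_eq, hre] at hn
  have e₁ := mul_nonneg (neg_pos.2 h₁).le (sq_nonneg g.imI)
  have e₂ := mul_nonneg (neg_pos.2 h₂).le (sq_nonneg g.imJ)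
  have e₃ := mul_nonneg hc.le (sq_nonneg g.imK)
  have q : (0 : ℚ) ≤ (N : ℚ) ^ 2 * n := by positivity
  have q₁ := mul_nonneg q p₁.le
  have q₂ := mul_nonneg q p₂.le
  have q₃ := mul_nonneg q p₃.le
  refine ⟨(a, b, c), ⟨bound (neg_pos.2 h₁) ha (by linarith) (by linarith),
    bound (neg_pos.2 h₂) hb (by linarith) (by linarith), bound hc hc' (by linarith)
    (by linarith)⟩, ?_⟩
  ext <;> simp [hre, ← ha, ← hb, ← hc', hN']

theorem exists_minimal (hO : IsOrder O) (h₁ : c₁ < 0) (h₂ : c₂ < 0)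
    {P : ℍ[ℚ, c₁, c₂] → Prop} (h : ∃ g ∈ GrossLattice O, P g) :
    ∃ g ∈ GrossLattice O, P g ∧ ∀ g' ∈ GrossLattice O, P g' → Nr g ≤ Nr g' := by
  have key : ∀ g ∈ GrossLattice O, ∃ n : ℕ, Nr g = n := by
    intro g hg
    obtain ⟨n, t, h⟩ := hO.exists_int_Nr_grossLattice hg
    refine ⟨(4 * n - t ^ 2).toNat, ?_⟩
    have h0 := Nr_nonneg h₁ h₂ g
    rw [h] at h0 ⊢
    have : (0 : ℤ) ≤ 4 * n - t ^ 2 := by exact_mod_cast h0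
    exact_mod_cast (Int.toNat_of_nonneg this).symm
  have hex : ∃ n : ℕ, ∃ g ∈ GrossLattice O, P g ∧ Nr g = n := by
    obtain ⟨g, hg, hP⟩ := h
    obtain ⟨n, hn⟩ := key g hg
    exact ⟨n, g, hg, hP, hn⟩
  classical
  obtain ⟨g, hg, hP, hn⟩ := Nat.find_spec hex
  refine ⟨g, hg, hP, fun g' hg' hP' => ?_⟩
  obtain ⟨m, hm⟩ := key g' hg'
  rw [hn, hm]
  exact_mod_cast Nat.find_min' hex ⟨g', hg', hP', hm⟩

end IsOrder

theorem exists_int_mul_sub_sq_le {A : ℚ} (hA : 0 ≤ A) (t : ℚ) :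
    ∃ n : ℤ, A * (t - n) ^ 2 ≤ A / 4 := by
  refine ⟨round t, ?_⟩
  have := abs_le.1 (abs_sub_round t)
  nlinarith [mul_nonneg hA (mul_nonneg (sub_nonneg.2 this.2) (neg_le_iff_add_nonneg.1 this.1))]

theorem exists_int_binary_le {A B x : ℚ} (hA : 0 < A) (hF : 0 ≤ B - x ^ 2 / A) (α β : ℚ) :
    ∃ l m : ℤ, A * (α - l) ^ 2 + B * (β - m) ^ 2 + 2 * x * (α - l) * (β - m) ≤
      A / 4 + (B - x ^ 2 / A) / 4 := by
  obtain ⟨m, hm⟩ := exists_int_mul_sub_sq_le hF β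
  obtain ⟨l, hl⟩ := exists_int_mul_sub_sq_le hA.le (α + x / A * (β - m))
  refine ⟨l, m, ?_⟩
  have : A * (α - l) ^ 2 + B * (β - m) ^ 2 + 2 * x * (α - l) * (β - m) =
      A * (α + x / A * (β - m) - l) ^ 2 + (B - x ^ 2 / A) * (β - m) ^ 2 := by
    field_simp; ring
  linarith

theorem exists_int_ternary_le {A B C x y z F G : ℚ} (hA : 0 < A) (hF : F = B - x ^ 2 / A)
    (hF0 : 0 < F) (hG : G = C - y ^ 2 / A - (z - x * y / A) ^ 2 / F) (α β γ : ℚ) :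
    ∃ l m : ℤ, A * (α - l) ^ 2 + B * (β - m) ^ 2 + C * γ ^ 2 + 2 * x * (α - l) * (β - m)
      + 2 * y * (α - l) * γ + 2 * z * (β - m) * γ ≤ A / 4 + F / 4 + G * γ ^ 2 := by
  obtain ⟨m, hm⟩ := exists_int_mul_sub_sq_le hF0.le (β + (z - x * y / A) / F * γ)
  obtain ⟨l, hl⟩ := exists_int_mul_sub_sq_le hA.le (α + x / A * (β - m) + y / A * γ)
  refine ⟨l, m, ?_⟩
  have : A * (α - l) ^ 2 + B * (β - m) ^ 2 + C * γ ^ 2 + 2 * x * (α - l) * (β - m)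
      + 2 * y * (α - l) * γ + 2 * z * (β - m) * γ =
      A * (α + x / A * (β - m) + y / A * γ - l) ^ 2
        + F * (β + (z - x * y / A) / F * γ - m) ^ 2 + G * γ ^ 2 := by
    have hB : B = F + x ^ 2 / A := by rw [hF]; ring
    rw [hG, hB]
    have := hF0.ne'
    clear hG hB hF
    field_simp
    ring
  linarith

/-- A basis of the lattice `L` realising the successive minima of the reduced norm. -/
structure IsReducedBasis (L : Submodule ℤ ℍ[ℚ, c₁, c₂]) (h₁ h₂ h₃ : ℍ[ℚ, c₁, c₂]) : Prop where
  mem₁ : h₁ ∈ L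
  mem₂ : h₂ ∈ L
  mem₃ : h₃ ∈ L
  exists_coords : ∀ g ∈ L, ∃ α β γ : ℤ, g = (α : ℚ) • h₁ + (β : ℚ) • h₂ + (γ : ℚ) • h₃
  indep : ∀ α β γ : ℚ, α • h₁ + β • h₂ + γ • h₃ = 0 → α = 0 ∧ β = 0 ∧ γ = 0
  min₁ : ∀ g ∈ L, g ≠ 0 → Nr h₁ ≤ Nr g
  min₂ : ∀ g ∈ L, (∀ α : ℚ, g ≠ α • h₁) → Nr h₂ ≤ Nr g
  min₃ : ∀ g ∈ L, (∀ α β : ℚ, g ≠ α • h₁ + β • h₂) → Nr h₃ ≤ Nr g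

theorem exists_coords_of_indep {h₁ h₂ h₃ : ℍ[ℚ, c₁, c₂]} (e₁ : h₁.re = 0) (e₂ : h₂.re = 0)
    (e₃ : h₃.re = 0) (h : ∀ α β γ : ℚ, α • h₁ + β • h₂ + γ • h₃ = 0 → α = 0 ∧ β = 0 ∧ γ = 0)
    {g : ℍ[ℚ, c₁, c₂]} (hg : g.re = 0) : ∃ α β γ : ℚ, g = α • h₁ + β • h₂ + γ • h₃ := by
  have hli : LinearIndependent ℚ ![1, h₁, h₂, h₃] := by
    rw [Fintype.linearIndependent_iff]
    intro f hf
    simp only [Fin.sum_univ_four, Matrix.cons_val] at hf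
    have h0 : f 0 = 0 := by
      have := congrArg QuaternionAlgebra.re hf
      simpa [e₁, e₂, e₃] using this
    rw [h0, zero_smul, zero_add] at hf
    obtain ⟨a, b, c⟩ := h _ _ _ hf
    intro i
    fin_cases i <;> assumption
  have hspan := hli.span_eq_top_of_card_eq_finrank
    (by rw [QuaternionAlgebra.finrank_eq_four, Fintype.card_fin])
  have hmem : g ∈ Submodule.span ℚ (Set.range ![1, h₁, h₂, h₃]) := hspan ▸ Submodule.mem_top
  obtain ⟨f, hf⟩ := (Submodule.mem_span_range_iff_exists_fun ℚ).1 hmem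
  simp only [Fin.sum_univ_four, Matrix.cons_val] at hf
  have h0 : f 0 = 0 := by
    have := congrArg QuaternionAlgebra.re hf
    simpa [e₁, e₂, e₃, hg] using this
  rw [h0, zero_smul, zero_add] at hf
  exact ⟨_, _, _, hf.symm⟩

theorem re_of_mem_grossLattice {O : Subalgebra ℤ ℍ[ℚ, c₁, c₂]} {g : ℍ[ℚ, c₁, c₂]}
    (hg : g ∈ GrossLattice O) : g.re = 0 := by
  obtain ⟨x, -, rfl⟩ := hg
  exact grossMap_re x

theorem sub_binary_pos (hc₁ : c₁ < 0) (hc₂ : c₂ < 0) {h₁ h₂ : ℍ[ℚ, c₁, c₂]}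
    (h : ∀ α β : ℚ, α • h₁ + β • h₂ = 0 → α = 0 ∧ β = 0) :
    0 < Nr h₂ - bil h₁ h₂ ^ 2 / Nr h₁ := by
  have h0 : 0 < Nr h₁ := Nr_pos hc₁ hc₂ fun h0 => by
    simpa using (h 1 0 (by simp [h0])).1
  have := Nr_pos hc₁ hc₂ (x := (-(bil h₁ h₂ / Nr h₁)) • h₁ + (1 : ℚ) • h₂)
    fun h0 => by simpa using (h _ _ h0).2
  rw [Nr_smul_add] at this
  convert this using 1
  field_simp
  ring

theorem IsOrder.exists_isReducedBasis {O : Subalgebra ℤ ℍ[ℚ, c₁, c₂]} (hO : IsOrder O)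
    (hc₁ : c₁ < 0) (hc₂ : c₂ < 0) : ∃ h₁ h₂ h₃, IsReducedBasis (GrossLattice O) h₁ h₂ h₃ := by
  obtain ⟨h₁, m₁, n₁, min₁⟩ := hO.exists_minimal hc₁ hc₂ (P := fun g => g ≠ 0) (by
    obtain ⟨g, hg, h⟩ := hO.exists_mem_grossLattice_notMem 0 0
    exact ⟨g, hg, by simpa using h⟩)
  obtain ⟨h₂, m₂, n₂, min₂⟩ := hO.exists_minimal hc₁ hc₂ (P := fun g => ∀ α : ℚ, g ≠ α • h₁) (by
    obtain ⟨g, hg, h⟩ := hO.exists_mem_grossLattice_notMem h₁ 0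
    exact ⟨g, hg, by simpa using h⟩)
  obtain ⟨h₃, m₃, n₃, min₃⟩ := hO.exists_minimal hc₁ hc₂
    (P := fun g => ∀ α β : ℚ, g ≠ α • h₁ + β • h₂) (hO.exists_mem_grossLattice_notMem h₁ h₂)
  have ind : ∀ α β γ : ℚ, α • h₁ + β • h₂ + γ • h₃ = 0 → α = 0 ∧ β = 0 ∧ γ = 0 := by
    intro α β γ h
    have hγ : γ = 0 := by
      by_contra hγ
      apply n₃ (-(γ⁻¹ * α)) (-(γ⁻¹ * β))
      rw [← inv_smul_smul₀ hγ h₃, ← neg_eq_of_add_eq_zero_right h]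
      module
    rw [hγ, zero_smul, add_zero] at h
    have hβ : β = 0 := by
      by_contra hβ
      apply n₂ (-(β⁻¹ * α))
      rw [← inv_smul_smul₀ hβ h₂, ← neg_eq_of_add_eq_zero_right h]
      module
    rw [hβ, zero_smul, add_zero] at h
    exact ⟨(smul_eq_zero.1 h).resolve_right n₁, hβ, hγ⟩
  refine ⟨h₁, h₂, h₃, m₁, m₂, m₃, fun g hg => ?_, ind, min₁, min₂, min₃⟩
  have hA : 0 < Nr h₁ := Nr_pos hc₁ hc₂ n₁
  have hAB : Nr h₁ ≤ Nr h₂ := min₁ _ m₂ fun h => n₂ 0 (by simpa using h)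
  have hBC : Nr h₂ ≤ Nr h₃ := min₂ _ m₃ fun α h => n₃ α 0 (by simpa using h)
  have hF := sub_binary_pos hc₁ hc₂ (h₁ := h₁) (h₂ := h₂) fun α β h => by
    obtain ⟨a, b, -⟩ := ind α β 0 (by simpa using h)
    exact ⟨a, b⟩
  have hFB : Nr h₂ - bil h₁ h₂ ^ 2 / Nr h₁ ≤ Nr h₂ := by
    have : 0 ≤ bil h₁ h₂ ^ 2 / Nr h₁ := by positivity
    linarith
  obtain ⟨α, β, γ, hg'⟩ := exists_coords_of_indep (re_of_mem_grossLattice m₁)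
    (re_of_mem_grossLattice m₂) (re_of_mem_grossLattice m₃) ind (re_of_mem_grossLattice hg)
  have hmem : ∀ {h : ℍ[ℚ, c₁, c₂]} (n : ℤ), h ∈ GrossLattice O → (n : ℚ) • h ∈ GrossLattice O :=
    fun n hh => by rw [Int.cast_smul_eq_zsmul]; exact Submodule.smul_mem _ n hh
  obtain ⟨n, hn⟩ := exists_int_mul_sub_sq_le (zero_le_one' ℚ) γ
  obtain ⟨l, m, hlm⟩ := exists_int_ternary_le (C := Nr h₃) (y := bil h₁ h₃) (z := bil h₂ h₃)
    hA rfl hF rfl α β (γ - n)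
  have hγ : γ = n := by
    set r : ℍ[ℚ, c₁, c₂] := (α - l) • h₁ + (β - m) • h₂ + (γ - n) • h₃ with hr
    have hrm : r ∈ GrossLattice O := by
      have : r = g - ((l : ℚ) • h₁ + (m : ℚ) • h₂ + (n : ℚ) • h₃) := by rw [hr, hg']; module
      rw [this]
      exact sub_mem hg (add_mem (add_mem (hmem l m₁) (hmem m m₂)) (hmem n m₃))
    by_contra hne
    have := min₃ r hrm fun α' β' h => hne (by
      have := (ind (α - l - α') (β - m - β') (γ - n) (by
        rw [← sub_eq_zero] at h; rw [← h, hr]; module)).2.2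
      linarith)
    rw [hr, Nr_smul_add_add] at this
    have h1 : (Nr h₃ - bil h₁ h₃ ^ 2 / Nr h₁ - (bil h₂ h₃ - bil h₁ h₂ * bil h₁ h₃ / Nr h₁) ^ 2 /
        (Nr h₂ - bil h₁ h₂ ^ 2 / Nr h₁)) * (γ - n) ^ 2 ≤ Nr h₃ * (1 / 4) := by
      have i1 : 0 ≤ bil h₁ h₃ ^ 2 / Nr h₁ := by positivity
      have i2 : 0 ≤ (bil h₂ h₃ - bil h₁ h₂ * bil h₁ h₃ / Nr h₁) ^ 2 /
        (Nr h₂ - bil h₁ h₂ ^ 2 / Nr h₁) := by positivity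
      calc _ ≤ Nr h₃ * (γ - n) ^ 2 := by gcongr; linarith
        _ ≤ _ := by gcongr <;> linarith
    linarith
  subst hγ
  obtain ⟨l, m, hlm⟩ := exists_int_binary_le hA hF.le α β
  have hβ : β = m := by
    set r : ℍ[ℚ, c₁, c₂] := (α - l) • h₁ + (β - m) • h₂ with hr
    have hrm : r ∈ GrossLattice O := by
      have : r = g - ((l : ℚ) • h₁ + (m : ℚ) • h₂ + (n : ℚ) • h₃) := by rw [hr, hg']; module
      rw [this]
      exact sub_mem hg (add_mem (add_mem (hmem l m₁) (hmem m m₂)) (hmem n m₃))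
    by_contra hne
    have := min₂ r hrm fun α' h => hne (by
      have := (ind (α - l - α') (β - m) 0 (by
        rw [← sub_eq_zero] at h; rw [← h, hr]; module)).2.1
      linarith)
    rw [hr, Nr_smul_add] at this
    linarith
  subst hβ
  obtain ⟨l, hl⟩ := exists_int_mul_sub_sq_le hA.le α
  have hα : α = l := by
    set r : ℍ[ℚ, c₁, c₂] := (α - l) • h₁ with hr
    have hrm : r ∈ GrossLattice O := by
      have : r = g - ((l : ℚ) • h₁ + (m : ℚ) • h₂ + (n : ℚ) • h₃) := by rw [hr, hg']; module
      rw [this]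
      exact sub_mem hg (add_mem (add_mem (hmem l m₁) (hmem m m₂)) (hmem n m₃))
    by_contra hne
    have := min₁ r hrm (smul_ne_zero (sub_ne_zero.2 hne) n₁)
    rw [hr, Nr_smul] at this
    linarith
  subst hα
  exact ⟨l, m, n, hg'⟩

theorem two_dvd_mul_sub {X Y Z : ℤ} (r s t u v : ℤ) (hX : X = 2 * r - u ^ 2)
    (hY : Y = 2 * s - v ^ 2) (hZ : Z = u * v - 2 * t) : 2 ∣ X * Y - Z := by
  obtain ⟨m, hm⟩ := Int.even_mul_pred_self (u * v)
  exact ⟨2 * r * s - r * v ^ 2 - s * u ^ 2 + t + m, by rw [hX, hY, hZ]; linear_combination hm⟩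

theorem bil_grossMap (x y : ℍ[ℚ, c₁, c₂]) :
    bil (grossMap x) (grossMap y) = 4 * x.re * y.re - 4 * (x * y).re := by
  rw [grossMap_eq, grossMap_eq, bil]; simp; ring

theorem bil_self (x : ℍ[ℚ, c₁, c₂]) : bil x x = Nr x := rfl

theorem bil_comm (x y : ℍ[ℚ, c₁, c₂]) : bil x y = bil y x := by simp [bil]; ring

theorem grossMap_add_zsmul_one (x : ℍ[ℚ, c₁, c₂]) (q : ℤ) : grossMap (x + q • 1) = grossMap x := by
  simp only [grossMap_eq, star_add, star_zsmul, star_one]; abel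

theorem two_mul_re_of_star {x : ℍ[ℚ, c₁, c₂]} {u : ℤ} (h : star x = u • 1 - x) :
    x.re = u / 2 := by
  have := congrArg QuaternionAlgebra.re h
  rw [← Int.cast_smul_eq_zsmul ℚ] at this
  simp at this
  linarith

theorem bil_grossMap_of_relations {x y z : ℍ[ℚ, c₁, c₂]} {u v w c : ℤ} (hx : star x = u • 1 - x)
    (hy : star y = v • 1 - y) (hz : star z = w • 1 - z) (h : x * y = (c * w) • 1 - c • z) :
    bil (grossMap x) (grossMap y) = ((u * v - 2 * c * w : ℤ) : ℚ) := by
  have := congrArg QuaternionAlgebra.re h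
  rw [← Int.cast_smul_eq_zsmul ℚ, ← Int.cast_smul_eq_zsmul ℚ] at this
  rw [bil_grossMap, this, two_mul_re_of_star hx, two_mul_re_of_star hy]
  simp [two_mul_re_of_star hz]
  ring

theorem Nr_grossMap_of_relations {x : ℍ[ℚ, c₁, c₂]} {u n : ℤ} (hx : star x = u • 1 - x)
    (h : x * x = u • x - n • 1) : Nr (grossMap x) = ((4 * n - u ^ 2 : ℤ) : ℚ) := by
  have := congrArg QuaternionAlgebra.re h
  rw [← Int.cast_smul_eq_zsmul ℚ, ← Int.cast_smul_eq_zsmul ℚ] at this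
  rw [← bil_self, bil_grossMap, this, two_mul_re_of_star hx]
  simp [two_mul_re_of_star hx]
  ring

/-- Properties of the Gram matrix of a reduced basis of the Gross lattice of a maximal order in a
quaternion algebra of discriminant `p`. -/
structure IsReducedGram (p : ℕ) (A B C x y z : ℤ) : Prop where
  three_le : 3 ≤ A
  A_le_B : A ≤ B
  B_le_C : B ≤ C
  abs_x_le : |2 * x| ≤ A
  abs_y_le : |2 * y| ≤ A
  abs_z_le : |2 * z| ≤ B
  det : A * B * C + 2 * x * y * z - A * z ^ 2 - B * y ^ 2 - C * x ^ 2 = 4 * (p : ℤ) ^ 2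
  mul_le : 3 * (A * B * C) ≤ 32 * (p : ℤ) ^ 2
  dvd_x : (p : ℤ) ∣ A * B - x ^ 2
  dvd_y : (p : ℤ) ∣ A * C - y ^ 2
  dvd_z : (p : ℤ) ∣ B * C - z ^ 2
  parity_x : 2 ∣ A * B - x
  parity_y : 2 ∣ A * C - y
  parity_z : 2 ∣ B * C - z

namespace IsReducedBasis
variable {O : Subalgebra ℤ ℍ[ℚ, c₁, c₂]} {L : Submodule ℤ ℍ[ℚ, c₁, c₂]} {h₁ h₂ h₃ : ℍ[ℚ, c₁, c₂]}

theorem ne_zero₁ (h : IsReducedBasis L h₁ h₂ h₃) : h₁ ≠ 0 := by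
  rintro rfl
  simpa using (h.indep 1 0 0 (by simp)).1

theorem ne_smul₂ (h : IsReducedBasis L h₁ h₂ h₃) (α : ℚ) : h₂ ≠ α • h₁ := by
  intro e
  simpa using (h.indep (-α) 1 0 (by rw [e]; module)).2.1

theorem ne_smul₃ (h : IsReducedBasis L h₁ h₂ h₃) (α β : ℚ) : h₃ ≠ α • h₁ + β • h₂ := by
  intro e
  simpa using (h.indep (-α) (-β) 1 (by rw [e]; module)).2.2

theorem smul_add_smul_mem (h : IsReducedBasis L h₁ h₂ h₃) (α β γ : ℤ) :
    (α : ℚ) • h₁ + (β : ℚ) • h₂ + (γ : ℚ) • h₃ ∈ L := by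
  simp only [Int.cast_smul_eq_zsmul]
  exact add_mem (add_mem (Submodule.smul_mem _ _ h.mem₁) (Submodule.smul_mem _ _ h.mem₂))
    (Submodule.smul_mem _ _ h.mem₃)

theorem Nr_le₁₂ (h : IsReducedBasis L h₁ h₂ h₃) : Nr h₁ ≤ Nr h₂ :=
  h.min₁ _ h.mem₂ fun e => h.ne_smul₂ 0 (by simpa using e)

theorem Nr_le₂₃ (h : IsReducedBasis L h₁ h₂ h₃) : Nr h₂ ≤ Nr h₃ :=
  h.min₂ _ h.mem₃ fun α e => h.ne_smul₃ α 0 (by simpa using e)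

theorem Nr_le_add₂ (h : IsReducedBasis L h₁ h₂ h₃) (α : ℤ) :
    Nr h₂ ≤ α ^ 2 * Nr h₁ + Nr h₂ + 2 * α * bil h₁ h₂ := by
  have := h.min₂ ((α : ℚ) • h₁ + (1 : ℚ) • h₂)
    (by simpa using h.smul_add_smul_mem α 1 0)
    (fun β e => h.ne_smul₂ (β - α) (by rw [sub_smul, ← e]; module))
  rw [Nr_smul_add] at this
  linarith

theorem Nr_le_add₃ (h : IsReducedBasis L h₁ h₂ h₃) (α β : ℤ) :
    Nr h₃ ≤ α ^ 2 * Nr h₁ + β ^ 2 * Nr h₂ + Nr h₃ + 2 * α * β * bil h₁ h₂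
      + 2 * α * bil h₁ h₃ + 2 * β * bil h₂ h₃ := by
  have := h.min₃ ((α : ℚ) • h₁ + (β : ℚ) • h₂ + (1 : ℚ) • h₃)
    (by simpa using h.smul_add_smul_mem α β 1)
    (fun α' β' e => h.ne_smul₃ (α' - α) (β' - β) (by
      rw [← sub_eq_zero] at e ⊢; rw [← e]; module))
  rw [Nr_smul_add_add] at this
  linarith

theorem abs_two_mul_bil₁₂_le (h : IsReducedBasis L h₁ h₂ h₃) : |2 * bil h₁ h₂| ≤ Nr h₁ := by
  have a := h.Nr_le_add₂ 1
  have b := h.Nr_le_add₂ (-1)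
  push_cast at a b
  rw [abs_le]; constructor <;> linarith

theorem abs_two_mul_bil₁₃_le (h : IsReducedBasis L h₁ h₂ h₃) : |2 * bil h₁ h₃| ≤ Nr h₁ := by
  have a := h.Nr_le_add₃ 1 0
  have b := h.Nr_le_add₃ (-1) 0
  push_cast at a b
  rw [abs_le]; constructor <;> linarith

theorem abs_two_mul_bil₂₃_le (h : IsReducedBasis L h₁ h₂ h₃) : |2 * bil h₂ h₃| ≤ Nr h₂ := by
  have a := h.Nr_le_add₃ 0 1
  have b := h.Nr_le_add₃ 0 (-1)
  push_cast at a b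
  rw [abs_le]; constructor <;> linarith

theorem mul_le_det (hc₁ : c₁ < 0) (hc₂ : c₂ < 0) (h : IsReducedBasis L h₁ h₂ h₃) :
    3 * (Nr h₁ * Nr h₂ * Nr h₃) ≤ 8 * (Nr h₁ * Nr h₂ * Nr h₃ + 2 * bil h₁ h₂ * bil h₁ h₃ * bil h₂ h₃
      - Nr h₁ * bil h₂ h₃ ^ 2 - Nr h₂ * bil h₁ h₃ ^ 2 - Nr h₃ * bil h₁ h₂ ^ 2) := by
  have hA : 0 < Nr h₁ := Nr_pos hc₁ hc₂ h.ne_zero₁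
  have hAB := h.Nr_le₁₂
  have hBC := h.Nr_le₂₃
  have hF0 := sub_binary_pos hc₁ hc₂ (h₁ := h₁) (h₂ := h₂) fun α β e => by
    obtain ⟨a, b, -⟩ := h.indep α β 0 (by simpa using e)
    exact ⟨a, b⟩
  obtain ⟨l, m, hlm⟩ := exists_int_ternary_le (C := Nr h₃) (y := bil h₁ h₃) (z := bil h₂ h₃)
    hA rfl hF0 rfl 0 0 1
  have hmin := h.Nr_le_add₃ (-l) (-m)
  push_cast at hmin
  have hx := h.abs_two_mul_bil₁₂_le
  generalize Nr h₁ = A, Nr h₂ = B, Nr h₃ = C, bil h₁ h₂ = x, bil h₁ h₃ = y, bil h₂ h₃ = z at *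
  set F := B - x ^ 2 / A with hF
  set G := C - y ^ 2 / A - (z - x * y / A) ^ 2 / F with hG
  have hFB : F ≤ B := by
    have : 0 ≤ x ^ 2 / A := by positivity
    linarith
  have hF34 : 3 / 4 * B ≤ F := by
    have : x ^ 2 / A ≤ A / 4 := by
      rw [div_le_iff₀ hA]
      have := sq_le_sq' (abs_le.1 hx).1 (abs_le.1 hx).2
      linarith
    linarith
  have hG2 : C / 2 ≤ G := by linarith
  have hdet : A * B * C + 2 * x * y * z - A * z ^ 2 - B * y ^ 2 - C * x ^ 2 = A * F * G := by
    have hB : B = F + x ^ 2 / A := by rw [hF]; ring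
    rw [hG, hB]
    have := hF0.ne'
    clear_value F
    field_simp
    ring
  rw [hdet]
  have hB : 0 < B := hA.trans_le hAB
  have hC : 0 < C := hB.trans_le hBC
  calc 3 * (A * B * C) = 8 * (A * (3 / 4 * B) * (C / 2)) := by ring
    _ ≤ 8 * (A * F * G) := by gcongr

theorem exists_isReducedGram {p : ℕ} [Fact p.Prime] (hram : RamifiedExactlyAt p c₁ c₂)
    (hO : IsMaximalOrder O) (h : IsReducedBasis (GrossLattice O) h₁ h₂ h₃) :
    ∃ A B C x y z : ℤ, Nr h₁ = A ∧ Nr h₂ = B ∧ Nr h₃ = C ∧ bil h₁ h₂ = x ∧ bil h₁ h₃ = y ∧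
      bil h₂ h₃ = z ∧ IsReducedGram p A B C x y z := by
  obtain ⟨hc₁, hc₂⟩ := neg_of_ramified hram
  obtain ⟨i, hi, ei⟩ := h.mem₁
  obtain ⟨j, hj, ej⟩ := h.mem₂
  obtain ⟨k, hk, ek⟩ := h.mem₃
  obtain ⟨a, b, c, u, v, w, q, r, s, hg, hgO⟩ :=
    hO.1.exists_isGoodBasis hc₁.ne hc₂.ne hi hj hk fun t ht => by
      obtain ⟨α, β, γ, e⟩ := h.exists_coords _ ⟨t, ht, rfl⟩
      simp only [Int.cast_smul_eq_zsmul] at e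
      set o := t - (α • i + β • j + γ • k) with ho
      have hoO : o ∈ O := sub_mem ht (add_mem (add_mem (zsmul_mem hi α) (zsmul_mem hj β))
        (zsmul_mem hk γ))
      have h0 : grossMap o = 0 := by
        rw [ho, map_sub, e, ← ei, ← ej, ← ek]; simp only [map_add, map_smul, sub_self]
      rw [grossMap_eq] at h0
      have hre : o = o.re • 1 := by
        have h1 := congrArg QuaternionAlgebra.imI h0
        have h2 := congrArg QuaternionAlgebra.imJ h0
        have h3 := congrArg QuaternionAlgebra.imK h0
        simp at h1 h2 h3
        ext <;> simp <;> linarith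
      obtain ⟨m, hm⟩ := hO.1.exists_int_Nr hoO
      obtain ⟨n, hn⟩ := exists_int_of_root (q := o.re) (t := 0) (n := -m) (by
        rw [hre, Nr_smul, Nr_one] at hm
        push_cast
        linarith)
      refine ⟨n, α, β, γ, ?_⟩
      rw [← Int.cast_smul_eq_zsmul ℚ n, ← hn, ← hre, ho]
      abel
  have hd := IsCliffordOrder.natAbs_halfDisc hram hO ⟨_, _, _, hg, hgO⟩
  have hd2 : halfDisc a b c u v w ^ 2 = (p : ℤ) ^ 2 := by rw [← hd, Int.natCast_natAbs, sq_abs]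
  have hpd : (p : ℤ) ∣ halfDisc a b c u v w := by rw [Int.natCast_dvd, hd]
  rw [← grossMap_add_zsmul_one i q] at ei
  rw [← grossMap_add_zsmul_one j r] at ej
  rw [← grossMap_add_zsmul_one k s] at ek
  have e₁ := Nr_grossMap_of_relations hg.star_i hg.ii
  have e₂ := Nr_grossMap_of_relations hg.star_j hg.jj
  have e₃ := Nr_grossMap_of_relations hg.star_k hg.kk
  have e₁₂ := bil_grossMap_of_relations hg.star_i hg.star_j hg.star_k hg.ij
  have e₂₃ := bil_grossMap_of_relations hg.star_j hg.star_k hg.star_i hg.jk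
  have e₁₃ := bil_grossMap_of_relations hg.star_k hg.star_i hg.star_j hg.ki
  rw [bil_comm] at e₁₃
  rw [ei] at e₁ e₁₂ e₁₃
  rw [ej] at e₂ e₁₂ e₂₃
  rw [ek] at e₃ e₁₃ e₂₃
  have t := hO.1.three_le_Nr_grossLattice hc₁ hc₂ h.mem₁ h.ne_zero₁
  have t₁ := h.Nr_le₁₂
  have t₂ := h.Nr_le₂₃
  have t₃ := h.abs_two_mul_bil₁₂_le
  have t₄ := h.abs_two_mul_bil₁₃_le
  have t₅ := h.abs_two_mul_bil₂₃_le
  have t₆ := h.mul_le_det hc₁ hc₂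
  rw [e₁, e₂, e₃, e₁₂, e₁₃, e₂₃] at t₆
  rw [e₁] at t t₁ t₃ t₄
  rw [e₂] at t₁ t₂ t₅
  rw [e₃] at t₂
  rw [e₁₂] at t₃
  rw [e₁₃] at t₄
  rw [e₂₃] at t₅
  refine ⟨_, _, _, _, _, _, e₁, e₂, e₃, e₁₂, e₁₃, e₂₃, ?_⟩
  have hdet : (4 * (b * c) - u ^ 2) * (4 * (a * c) - v ^ 2) * (4 * (a * b) - w ^ 2) +
      2 * (u * v - 2 * c * w) * (w * u - 2 * b * v) * (v * w - 2 * a * u) -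
      (4 * (b * c) - u ^ 2) * (v * w - 2 * a * u) ^ 2 -
      (4 * (a * c) - v ^ 2) * (w * u - 2 * b * v) ^ 2 -
      (4 * (a * b) - w ^ 2) * (u * v - 2 * c * w) ^ 2 = 4 * (p : ℤ) ^ 2 := by
    rw [← hd2, halfDisc]; ring
  refine ⟨by exact_mod_cast t, by exact_mod_cast t₁, by exact_mod_cast t₂, by exact_mod_cast t₃,
    by exact_mod_cast t₄, by exact_mod_cast t₅, hdet, ?_, ?_, ?_, ?_, ?_, ?_, ?_⟩
  · have : 3 * ((4 * (b * c) - u ^ 2) * (4 * (a * c) - v ^ 2) * (4 * (a * b) - w ^ 2)) ≤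
        8 * ((4 * (b * c) - u ^ 2) * (4 * (a * c) - v ^ 2) * (4 * (a * b) - w ^ 2) +
      2 * (u * v - 2 * c * w) * (w * u - 2 * b * v) * (v * w - 2 * a * u) -
      (4 * (b * c) - u ^ 2) * (v * w - 2 * a * u) ^ 2 -
      (4 * (a * c) - v ^ 2) * (w * u - 2 * b * v) ^ 2 -
      (4 * (a * b) - w ^ 2) * (u * v - 2 * c * w) ^ 2) := by exact_mod_cast t₆
    linarith
  · exact (hpd.mul_left (4 * c)).trans (dvd_of_eq (by rw [halfDisc]; ring))
  · exact (hpd.mul_left (4 * b)).trans (dvd_of_eq (by rw [halfDisc]; ring))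
  · exact (hpd.mul_left (4 * a)).trans (dvd_of_eq (by rw [halfDisc]; ring))
  · exact two_dvd_mul_sub (2 * (b * c)) (2 * (a * c)) (c * w) u v (by ring) (by ring) (by ring)
  · exact two_dvd_mul_sub (2 * (b * c)) (2 * (a * b)) (b * v) u w (by ring) (by ring) (by ring)
  · exact two_dvd_mul_sub (2 * (a * c)) (2 * (a * b)) (a * u) v w (by ring) (by ring) (by ring)

end IsReducedBasis

theorem mul_self_of_re_eq_zero {u : ℍ[ℚ, c₁, c₂]} (hu : u.re = 0) : u * u = (-Nr u) • 1 := by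
  ext <;> simp [Nr, hu] <;> ring

theorem mul_swap_of_re_eq_zero {u v : ℍ[ℚ, c₁, c₂]} (hu : u.re = 0) (hv : v.re = 0) :
    v * u = (-2 * bil u v) • 1 - u * v := by
  ext <;> simp [bil, hu, hv] <;> ring

theorem bil_eq_Nr (x y : ℍ[ℚ, c₁, c₂]) : bil x y = (Nr (x + y) - Nr x - Nr y) / 2 := by
  simp [bil, Nr]; ring

theorem mul_ne_zero_of_definite (h₁ : c₁ < 0) (h₂ : c₂ < 0) {x y : ℍ[ℚ, c₁, c₂]} (hx : x ≠ 0)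
    (hy : y ≠ 0) : x * y ≠ 0 := by
  intro h
  have := mul_pos (Nr_pos h₁ h₂ hx) (Nr_pos h₁ h₂ hy)
  rw [← Nr_mul, h, Nr_zero] at this
  exact this.false

theorem exists_inverse (h₁ : c₁ < 0) (h₂ : c₂ < 0) {c : ℍ[ℚ, c₁, c₂]} (hc : c ≠ 0) :
    ∃ d, c * d = 1 ∧ d * c = 1 := by
  have := (Nr_pos h₁ h₂ hc).ne'
  refine ⟨(Nr c)⁻¹ • star c, ?_, ?_⟩
  · rw [mul_smul_comm, mul_star_self, inv_smul_smul₀ this]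
  · rw [smul_mul_assoc, star_mul_self_eq, inv_smul_smul₀ this]

section conj
variable {c d : ℍ[ℚ, c₁, c₂]}

theorem conj_eq_of_mul_eq (hcd : c * d = 1) {x y : ℍ[ℚ, c₁, c₂]} (h : c * x = y * c) :
    c * x * d = y := by
  rw [h, mul_assoc, hcd, mul_one]

theorem re_conj (hdc : d * c = 1) (x : ℍ[ℚ, c₁, c₂]) : (c * x * d).re = x.re := by
  have : ∀ x y : ℍ[ℚ, c₁, c₂], (x * y).re = (y * x).re := fun x y => by simp; ring
  rw [this, ← mul_assoc, hdc, one_mul]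

theorem Nr_conj (hcd : c * d = 1) (x : ℍ[ℚ, c₁, c₂]) : Nr (c * x * d) = Nr x := by
  rw [Nr_mul, Nr_mul, mul_right_comm, ← Nr_mul, hcd, Nr_one, one_mul]

theorem bil_conj (hcd : c * d = 1) (x y : ℍ[ℚ, c₁, c₂]) :
    bil (c * x * d) (c * y * d) = bil x y := by
  rw [bil_eq_Nr, bil_eq_Nr x, ← add_mul, ← mul_add, Nr_conj hcd, Nr_conj hcd, Nr_conj hcd]

end conj

section
variable {u v : ℍ[ℚ, c₁, c₂]}

theorem eq_smul_of_commute (h₁ : c₁ < 0) (h₂ : c₂ < 0) (hu : u.re = 0) (hv : v.re = 0)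
    (hu0 : u ≠ 0) (h : u * v = v * u) : v = (bil u v / Nr u) • u := by
  have hN := (Nr_pos h₁ h₂ hu0).ne'
  have e : u * v = (-bil u v) • 1 := by
    have := mul_swap_of_re_eq_zero hu hv
    rw [← h] at this
    have h2 : (2 : ℚ) • (u * v) = (2 : ℚ) • ((-bil u v) • (1 : ℍ[ℚ, c₁, c₂])) := by
      rw [two_smul]; nth_rewrite 1 [this]; module
    exact smul_right_injective _ two_ne_zero h2
  have : u * (u * v) = u * ((-bil u v) • 1) := by rw [e]
  rw [← mul_assoc, mul_self_of_re_eq_zero hu, smul_mul_assoc, one_mul, mul_smul_comm, mul_one] at this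
  have := congrArg (fun t => (-Nr u)⁻¹ • t) this
  simp only [inv_smul_smul₀ (neg_ne_zero.2 hN), smul_smul] at this
  rw [show bil u v / Nr u = (-Nr u)⁻¹ * -bil u v by field_simp]
  exact this

theorem commutator_ne_zero (h₁ : c₁ < 0) (h₂ : c₂ < 0) (hu : u.re = 0) (hv : v.re = 0)
    (hu0 : u ≠ 0) (h : ∀ α : ℚ, v ≠ α • u) : u * v - v * u ≠ 0 := fun h0 =>
  h _ (eq_smul_of_commute h₁ h₂ hu hv hu0 (sub_eq_zero.1 h0))

theorem commutator_mul_left (hu : u.re = 0) :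
    (u * v - v * u) * u = -u * (u * v - v * u) := by
  have := mul_self_of_re_eq_zero hu
  have e : (u * v - v * u) * u = u * v * u - v * (u * u) := by noncomm_ring
  have e' : -u * (u * v - v * u) = u * v * u - u * u * v := by noncomm_ring
  rw [e, e', this, mul_smul_comm, smul_mul_assoc, mul_one, one_mul]

theorem commutator_mul_right (hv : v.re = 0) :
    (u * v - v * u) * v = -v * (u * v - v * u) := by
  rw [← neg_sub (v * u), neg_mul, commutator_mul_left hv, mul_neg]

theorem exists_mul_eq_mul_of_Nr_eq (h₁ : c₁ < 0) (h₂ : c₂ < 0) {u' : ℍ[ℚ, c₁, c₂]} (hu : u.re = 0)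
    (hu' : u'.re = 0) (hv : v.re = 0) (hu0 : u ≠ 0) (h : ∀ α : ℚ, v ≠ α • u) (hN : Nr u = Nr u') :
    ∃ c ≠ 0, c * u = u' * c := by
  by_cases h0 : u + u' = 0
  · refine ⟨u * v - v * u, commutator_ne_zero h₁ h₂ hu hv hu0 h, ?_⟩
    rw [commutator_mul_left hu, neg_eq_of_add_eq_zero_right h0]
  · refine ⟨u + u', h0, ?_⟩
    rw [add_mul, mul_add, mul_self_of_re_eq_zero hu, mul_self_of_re_eq_zero hu', hN, add_comm]

theorem exists_mul_eq_mul_of_bil_eq (h₁ : c₁ < 0) (h₂ : c₂ < 0) {v' : ℍ[ℚ, c₁, c₂]} (hu : u.re = 0)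
    (hv : v.re = 0) (hv' : v'.re = 0) (hu0 : u ≠ 0) (h : ∀ α : ℚ, v ≠ α • u) (hN : Nr v = Nr v')
    (hb : bil u v = bil u v') :
    ∃ c ≠ 0, c * u = u * c ∧ c * v = v' * c := by
  have hNu := (Nr_pos h₁ h₂ hu0).ne'
  set V := Nr u • v - bil u v • u with hV
  set V' := Nr u • v' - bil u v • u with hV'
  have anti : ∀ {x : ℍ[ℚ, c₁, c₂]}, x.re = 0 → bil u v = bil u x →
      (Nr u • x - bil u v • u) * u = -u * (Nr u • x - bil u v • u) := by
    intro x hx hb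
    rw [hb]
    simp only [sub_mul, mul_sub, neg_mul, smul_mul_assoc, mul_smul_comm,
      mul_swap_of_re_eq_zero hu hx, mul_self_of_re_eq_zero hu]
    module
  have a := anti hv rfl
  have a' := anti hv' hb
  rw [← hV] at a
  rw [← hV'] at a'
  have hVre : V.re = 0 := by simp [hV, hu, hv]
  have hVre' : V'.re = 0 := by simp [hV', hu, hv']
  have hV0 : V ≠ 0 := by
    intro h0
    apply h ((Nr u)⁻¹ * bil u v)
    rw [hV, sub_eq_zero] at h0
    rw [← smul_smul, ← h0, inv_smul_smul₀ hNu]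
  have hsq : V' * V' = V * V := by
    rw [mul_self_of_re_eq_zero hVre, mul_self_of_re_eq_zero hVre']
    congr 2
    have e1 : V = Nr u • v + (-bil u v) • u := by rw [hV]; module
    have e2 : V' = Nr u • v' + (-bil u v) • u := by rw [hV']; module
    rw [e1, e2, Nr_smul_add, Nr_smul_add, bil_comm v' u, bil_comm v u, hN, ← hb]
  have lift : ∀ {c : ℍ[ℚ, c₁, c₂]}, c * u = u * c → c * V = V' * c → c * v = v' * c := by
    intro c e1 e2
    have : Nr u • (c * v) = Nr u • (v' * c) := by
      have f : Nr u • v = V + bil u v • u := by rw [hV]; abel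
      have f' : Nr u • v' = V' + bil u v • u := by rw [hV']; abel
      rw [← mul_smul_comm, ← smul_mul_assoc, f, f', mul_add, add_mul, e2, mul_smul_comm,
        smul_mul_assoc, e1]
    exact smul_right_injective _ hNu this
  clear_value V V'
  by_cases h0 : V + V' = 0
  · refine ⟨u, hu0, rfl, lift rfl ?_⟩
    rw [← neg_eq_of_add_eq_zero_right h0, neg_mul, a, neg_mul, neg_neg]
  · have e1 : V * V * u = u * (V * V) := by
      rw [mul_assoc, a, ← mul_assoc, mul_neg, a]; noncomm_ring
    have e2 : V' * V * u = u * (V' * V) := by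
      rw [mul_assoc, a, ← mul_assoc, mul_neg, a']; noncomm_ring
    refine ⟨(V + V') * V, mul_ne_zero_of_definite h₁ h₂ h0 hV0, ?_, lift ?_ ?_⟩
    · rw [add_mul, add_mul, mul_add, e1, e2]
    · rw [add_mul, add_mul, mul_add, e1, e2]
    · have e3 : V' * ((V + V') * V) = V' * V * V + V' * V' * V := by noncomm_ring
      rw [e3, hsq]; noncomm_ring

theorem eq_or_mul_eq_neg_mul (h₁ : c₁ < 0) (h₂ : c₂ < 0) {w w' : ℍ[ℚ, c₁, c₂]} (hu : u.re = 0)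
    (hv : v.re = 0) (hw : w.re = 0) (hw' : w'.re = 0) (hu0 : u ≠ 0) (h : ∀ α : ℚ, v ≠ α • u)
    (hN : Nr w = Nr w') (hbu : bil u w = bil u w') (hbv : bil v w = bil v w') :
    w = w' ∨ (u * v - v * u) * w = -w' * (u * v - v * u) := by
  set n := u * v - v * u with hn
  have hn0 : n ≠ 0 := commutator_ne_zero h₁ h₂ hu hv hu0 h
  have hnre : n.re = 0 := by simp [hn]; ring
  have hdre : (w - w').re = 0 := by simp [hw, hw']
  have anti : ∀ {x : ℍ[ℚ, c₁, c₂]}, x.re = 0 → bil x w = bil x w' →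
      (w - w') * x = -(x * (w - w')) := by
    intro x hx hb
    rw [mul_swap_of_re_eq_zero hx hdre]
    have : bil x (w - w') = 0 := by
      rw [← sub_eq_zero] at hb
      refine Eq.trans ?_ hb
      simp [bil]; ring
    rw [this]; simp
  have au := anti hu hbu
  have av := anti hv hbv
  have hcomm : n * (w - w') = (w - w') * n := by
    have e1 : (w - w') * (u * v) = u * v * (w - w') := by
      rw [← mul_assoc, au, neg_mul, mul_assoc, av]; noncomm_ring
    have e2 : (w - w') * (v * u) = v * u * (w - w') := by
      rw [← mul_assoc, av, neg_mul, mul_assoc, au]; noncomm_ring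
    rw [hn, sub_mul, mul_sub (w - w'), e1, e2]
  have hd := eq_smul_of_commute h₁ h₂ hnre hdre hn0 hcomm
  set t := bil n (w - w') / Nr n with ht
  rcases eq_or_ne t 0 with h0 | h0
  · left; rw [h0, zero_smul] at hd; exact sub_eq_zero.1 hd
  right
  have hwt : w = (1 : ℚ) • w' + t • n := by rw [← hd]; module
  have hNr := hN
  rw [hwt, Nr_smul_add] at hNr
  have hb : t * Nr n + 2 * bil w' n = 0 := by
    have : t * (t * Nr n + 2 * bil w' n) = 0 := by linarith
    exact (mul_eq_zero.1 this).resolve_left h0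
  clear_value t n
  rw [hwt, one_smul, mul_add, mul_smul_comm, mul_self_of_re_eq_zero hnre,
    mul_swap_of_re_eq_zero hw' hnre]
  have : t • (-Nr n) • (1 : ℍ[ℚ, c₁, c₂]) = (2 * bil w' n) • 1 := by
    rw [smul_smul]; congr 1; linarith
  rw [this, neg_mul w' n]
  module

end

theorem exists_conj_of_gram_eq (h₁ : c₁ < 0) (h₂ : c₂ < 0) {u v w u' v' w' : ℍ[ℚ, c₁, c₂]}
    (hu : u.re = 0) (hv : v.re = 0) (hw : w.re = 0) (hu' : u'.re = 0) (hv' : v'.re = 0)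
    (hw' : w'.re = 0) (hu0 : u ≠ 0) (h : ∀ α : ℚ, v ≠ α • u) (eu : Nr u = Nr u') (ev : Nr v = Nr v')
    (ew : Nr w = Nr w') (euv : bil u v = bil u' v') (euw : bil u w = bil u' w')
    (evw : bil v w = bil v' w') :
    ∃ c d ε, c * d = 1 ∧ d * c = 1 ∧ (ε = 1 ∨ ε = -1) ∧ c * u * d = ε * u' ∧ c * v * d = ε * v' ∧
      c * w * d = ε * w' := by
  obtain ⟨c, hc, e⟩ := exists_mul_eq_mul_of_Nr_eq h₁ h₂ hu hu' hv hu0 h eu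
  obtain ⟨d, hcd, hdc⟩ := exists_inverse h₁ h₂ hc
  have cu := conj_eq_of_mul_eq hcd e
  have hcu0 : u' ≠ 0 := by
    rintro rfl
    rw [Nr_zero] at eu
    exact (Nr_pos h₁ h₂ hu0).ne' eu
  have hcv : ∀ α : ℚ, c * v * d ≠ α • u' := by
    intro α e
    apply h α
    rw [← cu] at e
    have := congrArg (fun t => d * t * c) e
    simp only [mul_smul_comm, smul_mul_assoc] at this
    have f : ∀ x, d * (c * x * d) * c = x := fun x => by
      rw [mul_assoc, mul_assoc (c * x), hdc, mul_one, ← mul_assoc, hdc, one_mul]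
    rwa [f, f] at this
  obtain ⟨c', hc', f, e'⟩ := exists_mul_eq_mul_of_bil_eq h₁ h₂ hu'
    ((re_conj hdc v).trans hv) hv' hcu0 hcv ((Nr_conj hcd v).trans ev)
    (by rw [← euv, ← bil_conj hcd u v, cu])
  obtain ⟨d', hcd', hdc'⟩ := exists_inverse h₁ h₂ hc'
  have assoc : ∀ x, c' * c * x * (d * d') = c' * (c * x * d) * d' := fun x => by noncomm_ring
  have H₁ : (c' * c) * (d * d') = 1 := by
    rw [mul_assoc, ← mul_assoc c, hcd, one_mul, hcd']
  have H₂ : (d * d') * (c' * c) = 1 := by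
    rw [mul_assoc, ← mul_assoc d', hdc', one_mul, hdc]
  have ku : c' * c * u * (d * d') = u' := by
    rw [assoc, cu]; exact conj_eq_of_mul_eq hcd' f
  have kv : c' * c * v * (d * d') = v' := by
    rw [assoc]; exact conj_eq_of_mul_eq hcd' e'
  have hv0' : ∀ α : ℚ, v' ≠ α • u' := by
    intro α e
    apply hcv α
    have k := conj_eq_of_mul_eq hcd' e'
    have k' := conj_eq_of_mul_eq hcd' f
    rw [← k, ← k'] at e
    have := congrArg (fun t => d' * t * c') e
    simp only [mul_smul_comm, smul_mul_assoc] at this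
    have f : ∀ x, d' * (c' * x * d') * c' = x := fun x => by
      rw [mul_assoc, mul_assoc (c' * x), hdc', mul_one, ← mul_assoc, hdc', one_mul]
    rwa [f, f] at this
  generalize c' * c = C, d * d' = D at H₁ H₂ ku kv
  rcases eq_or_mul_eq_neg_mul h₁ h₂ hu' hv' ((re_conj H₂ w).trans hw) hw' hcu0 hv0'
    ((Nr_conj H₁ w).trans ew) (by rw [← euw, ← bil_conj H₁ u w, ku])
    (by rw [← evw, ← bil_conj H₁ v w, kv]) with kw | kw
  · exact ⟨C, D, 1, H₁, H₂, Or.inl rfl, by rw [ku, one_mul], by rw [kv, one_mul],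
      by rw [kw, one_mul]⟩
  · have hn0 := commutator_ne_zero h₁ h₂ hu' hv' hcu0 hv0'
    obtain ⟨m, hnm, hmn⟩ := exists_inverse h₁ h₂ hn0
    have nu := conj_eq_of_mul_eq hnm (commutator_mul_left (v := v') hu')
    have nv := conj_eq_of_mul_eq hnm (commutator_mul_right (u := u') hv')
    have nw := conj_eq_of_mul_eq hnm kw
    generalize u' * v' - v' * u' = n at *
    have assoc : ∀ x, n * C * x * (D * m) = n * (C * x * D) * m := fun x => by noncomm_ring
    refine ⟨n * C, D * m, -1, ?_, ?_, Or.inr rfl, ?_, ?_, ?_⟩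
    · rw [mul_assoc, ← mul_assoc C, H₁, one_mul, hnm]
    · rw [mul_assoc, ← mul_assoc m, hmn, one_mul, H₂]
    · rw [assoc, ku, nu, neg_one_mul]
    · rw [assoc, kv, nv, neg_one_mul]
    · rw [assoc, nw, neg_one_mul]

theorem abs_eq_abs_of_dvd_sq_sub {p : ℕ} (hp : p.Prime) {n x y : ℤ} (hx : |x| < p) (hy : |y| < p)
    (dx : (p : ℤ) ∣ n - x ^ 2) (dy : (p : ℤ) ∣ n - y ^ 2) (px : 2 ∣ n - x) (py : 2 ∣ n - y) :
    |x| = |y| := by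
  have hp' : Prime (p : ℤ) := Nat.prime_iff_prime_int.1 hp
  have h2 : 2 ∣ |x| + |y| := by
    rcases abs_choice x with h | h <;> rcases abs_choice y with h' | h' <;> rw [h, h'] <;> omega
  have hd : (p : ℤ) ∣ (|x| - |y|) * (|x| + |y|) := by
    have := dvd_sub dy dx
    rwa [show n - y ^ 2 - (n - x ^ 2) = |x| ^ 2 - |y| ^ 2 by rw [sq_abs, sq_abs]; ring,
      show |x| ^ 2 - |y| ^ 2 = (|x| - |y|) * (|x| + |y|) by ring] at this
  have hx0 := abs_nonneg x
  have hy0 := abs_nonneg y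
  rcases hp'.dvd_or_dvd hd with h | h
  · have := Int.eq_zero_of_abs_lt_dvd h (by rw [abs_lt]; constructor <;> linarith)
    linarith
  · obtain ⟨k, hk⟩ := h
    have hp0 : (0 : ℤ) < p := by exact_mod_cast hp.pos
    have hk0 : 0 ≤ k := by
      by_contra hk0
      nlinarith
    have hk2 : k < 2 := by
      by_contra hk2
      nlinarith
    interval_cases k
    · linarith
    · rw [mul_one] at hk
      have : p = 2 := ((Nat.prime_dvd_prime_iff_eq Nat.prime_two hp).1
        (by rw [hk] at h2; exact_mod_cast h2)).symm
      subst this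
      push_cast at *
      omega

namespace IsReducedGram
variable {p : ℕ} {A B C x y z : ℤ}

theorem B_lt (h : IsReducedGram p A B C x y z) (hp : 0 < p) : B < 2 * p := by
  by_contra! hB
  have hp0 : (0 : ℤ) < p := by exact_mod_cast hp
  have h1 := h.three_le
  have h2 := h.A_le_B
  have h3 := h.B_le_C
  have : 3 * (2 * (p : ℤ)) * (2 * p) ≤ A * B * C := by
    have : 3 * (2 * (p : ℤ)) ≤ A * B := mul_le_mul h1 hB (by positivity) (by linarith)
    exact mul_le_mul this (by linarith) (by positivity) (by nlinarith)
  have := h.mul_le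
  nlinarith

theorem abs_lt (h : IsReducedGram p A B C x y z) (hp : 0 < p) : |x| < p ∧ |y| < p ∧ |z| < p := by
  have h1 := h.A_le_B
  have h2 := h.B_lt hp
  have hx := h.abs_x_le
  have hy := h.abs_y_le
  have hz := h.abs_z_le
  simp only [abs_mul, abs_two] at hx hy hz
  refine ⟨?_, ?_, ?_⟩ <;> linarith

end IsReducedGram

theorem exists_signs {x y z x' y' z' : ℤ} (hx : |x| = |x'|) (hy : |y| = |y'|) (hz : |z| = |z'|)
    (h : x * y * z = x' * y' * z') : ∃ a b : ℤ, (a = 1 ∨ a = -1) ∧ (b = 1 ∨ b = -1) ∧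
      ∃ c : ℤ, (c = 1 ∨ c = -1) ∧ x = a * b * x' ∧ y = a * c * y' ∧ z = b * c * z' := by
  have sign : ∀ {s t : ℤ}, |s| = |t| → ∃ e : ℤ, (e = 1 ∨ e = -1) ∧ s = e * t := by
    intro s t h
    rcases abs_eq_abs.1 h with rfl | rfl
    · exact ⟨1, by simp, by simp⟩
    · exact ⟨-1, by simp, by simp⟩
  have neg : ∀ {e : ℤ}, (e = 1 ∨ e = -1) → (-e = 1 ∨ -e = -1) := by
    rintro e (rfl | rfl) <;> simp
  obtain ⟨e, he, ex⟩ := sign hx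
  obtain ⟨f, hf, ey⟩ := sign hy
  obtain ⟨g, hg, ez⟩ := sign hz
  have key : ∀ {e f g : ℤ}, (e = 1 ∨ e = -1) → (f = 1 ∨ f = -1) → (g = 1 ∨ g = -1) →
      e * f * g = 1 → x = e * x' → y = f * y' → z = g * z' →
      ∃ a b : ℤ, (a = 1 ∨ a = -1) ∧ (b = 1 ∨ b = -1) ∧
      ∃ c : ℤ, (c = 1 ∨ c = -1) ∧ x = a * b * x' ∧ y = a * c * y' ∧ z = b * c * z' := by
    intro e f g he hf hg h1 ex ey ez
    refine ⟨1, e, by simp, he, f, hf, by simpa using ex, by simpa using ey, ?_⟩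
    have : e * f = g := by
      rcases hg with rfl | rfl <;> linarith
    rw [this, ez]
  have h1 : e * f * g = 1 ∨ e * f * g = -1 := by
    rcases he with rfl | rfl <;> rcases hf with rfl | rfl <;> rcases hg with rfl | rfl <;> simp
  rcases h1 with h1 | h1
  · exact key he hf hg h1 ex ey ez
  have h0 : x' * y' * z' = 0 := by
    rw [ex, ey, ez] at h
    have : e * f * g * (x' * y' * z') = x' * y' * z' := by linear_combination h
    rw [h1] at this
    linarith
  simp only [mul_eq_zero, or_assoc] at h0
  rcases h0 with h0 | h0 | h0
  · exact key (neg he) hf hg (by linarith) (by simp [ex, h0]) ey ez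
  · exact key he (neg hf) hg (by linarith) ex (by simp [ey, h0]) ez
  · exact key he hf (neg hg) (by linarith) ex ey (by simp [ez, h0])

section
variable {O O' : Subalgebra ℤ ℍ[ℚ, c₁, c₂]}

theorem IsOrder.exists_Nr_eq_of_rCount_le (hO : IsOrder O) (hc₁ : c₁ < 0) (hc₂ : c₂ < 0)
    {ι : Type*} {T : Set ι} {f : ι → ℍ[ℚ, c₁, c₂]} (f' : ι → ℍ[ℚ, c₁, c₂]) {n : ℕ}
    (hle : rCount O n ≤ rCount O' n) (hinj : Set.InjOn f T)
    (hf : ∀ t ∈ T, f t ∈ GrossLattice O ∧ Nr (f t) = n) {h : ℍ[ℚ, c₁, c₂]}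
    (hh : h ∈ GrossLattice O) (hn : Nr h = n) (hT : ∀ t ∈ T, f t ≠ h) :
    ∃ g ∈ GrossLattice O', Nr g = n ∧ ∀ t ∈ T, g ≠ f' t := by
  by_contra! H
  have hfin := hO.finite_grossLattice hc₁ hc₂ n
  have hsub : f '' T ⊆ {h | h ∈ GrossLattice O ∧ Nr h = n} := by
    rintro _ ⟨t, ht, rfl⟩
    exact hf t ht
  have hTfin : T.Finite := Set.Finite.of_finite_image (hfin.subset hsub) hinj
  have hlt : (f '' T).ncard < {h | h ∈ GrossLattice O ∧ Nr h = n}.ncard :=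
    Set.ncard_lt_ncard (hsub.ssubset_of_ne fun e => by
      have : h ∈ f '' T := e ▸ ⟨hh, hn⟩
      obtain ⟨t, ht, e⟩ := this
      exact hT t ht e) hfin
  rw [hinj.ncard_image] at hlt
  have hle' : {h | h ∈ GrossLattice O' ∧ Nr h = n}.ncard ≤ T.ncard :=
    (Set.ncard_le_ncard (fun g hg => by
      obtain ⟨t, ht, e⟩ := H g hg.1 hg.2
      exact ⟨t, ht, e.symm⟩) (hTfin.image f')).trans (Set.ncard_image_le hTfin)
  exact absurd hle (not_le.2 (hle'.trans_lt hlt))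

theorem IsOrder.exists_nat_Nr (hO : IsOrder O) (hc₁ : c₁ < 0) (hc₂ : c₂ < 0) {g : ℍ[ℚ, c₁, c₂]}
    (hg : g ∈ GrossLattice O) (h0 : g ≠ 0) : ∃ n : ℕ, 1 ≤ n ∧ Nr g = n := by
  obtain ⟨n, t, h⟩ := hO.exists_int_Nr_grossLattice hg
  have := Nr_pos hc₁ hc₂ h0
  rw [h] at this ⊢
  have h1 : (0 : ℤ) < 4 * n - t ^ 2 := by exact_mod_cast this
  refine ⟨(4 * n - t ^ 2).toNat, by omega, ?_⟩
  exact_mod_cast (Int.toNat_of_nonneg h1.le).symm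

variable {h₁ h₂ h₃ k₁ k₂ k₃ : ℍ[ℚ, c₁, c₂]}

namespace IsReducedBasis

theorem Nr_le₁ (hO : IsOrder O) (hc₁ : c₁ < 0) (hc₂ : c₂ < 0)
    (h : IsReducedBasis (GrossLattice O) h₁ h₂ h₃) (k : IsReducedBasis (GrossLattice O') k₁ k₂ k₃)
    (hr : ∀ n : ℕ, 1 ≤ n → rCount O n = rCount O' n) : Nr k₁ ≤ Nr h₁ := by
  obtain ⟨n, hn, e⟩ := hO.exists_nat_Nr hc₁ hc₂ h.mem₁ h.ne_zero₁
  obtain ⟨g, hg, eg, -⟩ := hO.exists_Nr_eq_of_rCount_le hc₁ hc₂ (T := (∅ : Set ℕ)) (f := 0) 0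
    (hr n hn).le (by simp) (by simp) h.mem₁ e (by simp)
  rw [e, ← eg]
  refine k.min₁ g hg ?_
  rintro rfl
  rw [Nr_zero] at eg
  have : n = 0 := by exact_mod_cast eg.symm
  omega

theorem Nr_le₂ (hO : IsOrder O) (hc₁ : c₁ < 0) (hc₂ : c₂ < 0)
    (h : IsReducedBasis (GrossLattice O) h₁ h₂ h₃) (k : IsReducedBasis (GrossLattice O') k₁ k₂ k₃)
    (hr : ∀ n : ℕ, 1 ≤ n → rCount O n = rCount O' n) (e₁ : Nr h₁ = Nr k₁) : Nr k₂ ≤ Nr h₂ := by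
  obtain ⟨n, hn, e⟩ := hO.exists_nat_Nr hc₁ hc₂ h.mem₂ fun e => h.ne_smul₂ 0 (by simpa using e)
  obtain ⟨g, hg, eg, hT⟩ := hO.exists_Nr_eq_of_rCount_le hc₁ hc₂
    (T := {α : ℤ | (α : ℚ) ^ 2 * Nr h₁ = n}) (f := fun α => (α : ℚ) • h₁) (fun α => (α : ℚ) • k₁)
    (hr n hn).le (fun α _ β _ e => by
      have := (h.indep (α - β) 0 0 (by
        have e : (α : ℚ) • h₁ = (β : ℚ) • h₁ := e
        rw [sub_smul, e]; simp)).1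
      exact_mod_cast sub_eq_zero.1 this)
    (fun α hα => ⟨by simpa using h.smul_add_smul_mem α 0 0, by rw [Nr_smul]; exact hα⟩)
    h.mem₂ e (fun α _ => (h.ne_smul₂ α).symm)
  rw [e, ← eg]
  refine k.min₂ g hg fun q hq => ?_
  obtain ⟨α, β, γ, hc⟩ := k.exists_coords g hg
  have hα := (k.indep (α - q) β γ (by rw [sub_smul, ← hq, hc]; abel)).1
  rw [← sub_eq_zero.1 hα] at hq
  refine hT α ?_ hq
  rw [hq, Nr_smul] at eg
  change _ * _ = _
  rw [e₁, eg]

theorem Nr_le₃ (hO : IsOrder O) (hc₁ : c₁ < 0) (hc₂ : c₂ < 0)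
    (h : IsReducedBasis (GrossLattice O) h₁ h₂ h₃) (k : IsReducedBasis (GrossLattice O') k₁ k₂ k₃)
    (hr : ∀ n : ℕ, 1 ≤ n → rCount O n = rCount O' n) (e₁ : Nr h₁ = Nr k₁) (e₂ : Nr h₂ = Nr k₂)
    (e₁₂ : |bil h₁ h₂| = |bil k₁ k₂|) : Nr k₃ ≤ Nr h₃ := by
  obtain ⟨ε, hε, eε⟩ : ∃ ε : ℤ, ε * ε = 1 ∧ bil h₁ h₂ = ε * bil k₁ k₂ := by
    rcases abs_eq_abs.1 e₁₂ with e | e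
    · exact ⟨1, by simp, by simpa using e⟩
    · exact ⟨-1, by simp, by simpa using e⟩
  have hε' : (ε : ℚ) * ε = 1 := by exact_mod_cast hε
  obtain ⟨n, hn, e⟩ := hO.exists_nat_Nr hc₁ hc₂ h.mem₃ fun e => h.ne_smul₃ 0 0 (by simpa using e)
  obtain ⟨g, hg, eg, hT⟩ := hO.exists_Nr_eq_of_rCount_le hc₁ hc₂
    (T := {t : ℤ × ℤ | Nr ((t.1 : ℚ) • h₁ + (t.2 : ℚ) • h₂) = n})
    (f := fun t => (t.1 : ℚ) • h₁ + (t.2 : ℚ) • h₂)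
    (fun t => (t.1 : ℚ) • k₁ + ((ε * t.2 : ℤ) : ℚ) • k₂)
    (hr n hn).le (fun t _ t' _ e => by
      have e : (t.1 : ℚ) • h₁ + (t.2 : ℚ) • h₂ = (t'.1 : ℚ) • h₁ + (t'.2 : ℚ) • h₂ := e
      obtain ⟨a, b, -⟩ := h.indep (t.1 - t'.1) (t.2 - t'.2) 0 (by
        rw [← sub_eq_zero] at e
        rw [← e]; module)
      ext
      · exact_mod_cast sub_eq_zero.1 a
      · exact_mod_cast sub_eq_zero.1 b)
    (fun t ht => ⟨by simpa using h.smul_add_smul_mem t.1 t.2 0, ht⟩)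
    h.mem₃ e (fun t _ => (h.ne_smul₃ t.1 t.2).symm)
  rw [e, ← eg]
  refine k.min₃ g hg fun q r hq => ?_
  obtain ⟨α, β, γ, hc⟩ := k.exists_coords g hg
  obtain ⟨hα, hβ, -⟩ := k.indep (α - q) (β - r) γ (by
    rw [← sub_eq_zero.2 (hc.symm.trans hq)]; module)
  rw [← sub_eq_zero.1 hα, ← sub_eq_zero.1 hβ] at hq
  refine hT (α, ε * β) ?_ ?_
  · rw [hq, Nr_smul_add] at eg
    change Nr _ = _
    rw [Nr_smul_add, ← eg, e₁, e₂, eε]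
    push_cast
    linear_combination (β ^ 2 * Nr k₂ + 2 * α * β * bil k₁ k₂) * hε'
  · rw [hq, ← mul_assoc, hε, one_mul]

theorem eq_span {L : Submodule ℤ ℍ[ℚ, c₁, c₂]} (h : IsReducedBasis L h₁ h₂ h₃) :
    L = Submodule.span ℤ {h₁, h₂, h₃} := by
  apply le_antisymm
  · intro g hg
    obtain ⟨α, β, γ, e⟩ := h.exists_coords g hg
    simp only [Int.cast_smul_eq_zsmul] at e
    rw [e]
    refine add_mem (add_mem ?_ ?_) ?_ <;> exact Submodule.smul_mem _ _ (Submodule.subset_span (by simp))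
  · rw [Submodule.span_le]
    rintro _ (rfl | rfl | rfl)
    exacts [h.mem₁, h.mem₂, h.mem₃]

end IsReducedBasis

theorem span_smul_triple {a b c : ℤ} (ha : a = 1 ∨ a = -1) (hb : b = 1 ∨ b = -1)
    (hc : c = 1 ∨ c = -1) :
    Submodule.span ℤ {a • h₁, b • h₂, c • h₃} = Submodule.span ℤ {h₁, h₂, h₃} := by
  apply le_antisymm
  · rw [Submodule.span_le]
    rintro _ (rfl | rfl | rfl) <;>
    exact Submodule.smul_mem _ _ (Submodule.subset_span (by simp))
  · have mem : ∀ {ε : ℤ} {t : ℍ[ℚ, c₁, c₂]} {S : Set ℍ[ℚ, c₁, c₂]}, ε = 1 ∨ ε = -1 →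
        ε • t ∈ S → t ∈ Submodule.span ℤ S := by
      intro ε t S hε h
      have h' := Submodule.smul_mem (Submodule.span ℤ S) ε (Submodule.subset_span h)
      rcases hε with rfl | rfl
      · simpa only [one_smul] using h'
      · simpa only [neg_smul, one_smul, neg_neg] using h'
    rw [Submodule.span_le]
    rintro t (h | h | h) <;> rw [h]
    · exact mem ha (Or.inl rfl)
    · exact mem hb (Or.inr (Or.inl rfl))
    · exact mem hc (Or.inr (Or.inr rfl))

end

theorem Nr_zsmul_sign {a : ℤ} (ha : a = 1 ∨ a = -1) (x : ℍ[ℚ, c₁, c₂]) : Nr (a • x) = Nr x := by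
  rw [← Int.cast_smul_eq_zsmul ℚ, Nr_smul]
  rcases ha with rfl | rfl <;> simp

theorem bil_zsmul_zsmul (a b : ℤ) (x y : ℍ[ℚ, c₁, c₂]) : bil (a • x) (b • y) = a * b * bil x y := by
  rw [← Int.cast_smul_eq_zsmul ℚ, ← Int.cast_smul_eq_zsmul ℚ]
  simp [bil]; ring

theorem exists_conj_of_rCount_eq {p : ℕ} [hp : Fact p.Prime] (hram : RamifiedExactlyAt p c₁ c₂)
    {O O' : Subalgebra ℤ ℍ[ℚ, c₁, c₂]} (hO : IsMaximalOrder O) (hO' : IsMaximalOrder O')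
    (hr : ∀ n : ℕ, 1 ≤ n → rCount O n = rCount O' n) :
    ∃ c d : ℍ[ℚ, c₁, c₂], c * d = 1 ∧ d * c = 1 ∧
      (fun x => c * x * d) '' (GrossLattice O : Set ℍ[ℚ, c₁, c₂])
        = (GrossLattice O' : Set ℍ[ℚ, c₁, c₂]) := by
  obtain ⟨hc₁, hc₂⟩ := neg_of_ramified hram
  have hr' : ∀ n : ℕ, 1 ≤ n → rCount O' n = rCount O n := fun n hn => (hr n hn).symm
  obtain ⟨h₁, h₂, h₃, h⟩ := hO.1.exists_isReducedBasis hc₁ hc₂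
  obtain ⟨k₁, k₂, k₃, k⟩ := hO'.1.exists_isReducedBasis hc₁ hc₂
  obtain ⟨A, B, C, x, y, z, eA, eB, eC, ex, ey, ez, hg⟩ := h.exists_isReducedGram hram hO
  obtain ⟨A', B', C', x', y', z', eA', eB', eC', ex', ey', ez', kg⟩ :=
    k.exists_isReducedGram hram hO'
  have e₁ : Nr h₁ = Nr k₁ := le_antisymm (k.Nr_le₁ hO'.1 hc₁ hc₂ h hr') (h.Nr_le₁ hO.1 hc₁ hc₂ k hr)
  have e₂ : Nr h₂ = Nr k₂ := le_antisymm (k.Nr_le₂ hO'.1 hc₁ hc₂ h hr' e₁.symm)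
    (h.Nr_le₂ hO.1 hc₁ hc₂ k hr e₁)
  obtain rfl : A = A' := by rw [eA, eA'] at e₁; exact_mod_cast e₁
  obtain rfl : B = B' := by rw [eB, eB'] at e₂; exact_mod_cast e₂
  obtain ⟨lx, ly, lz⟩ := hg.abs_lt hp.out.pos
  obtain ⟨lx', ly', lz'⟩ := kg.abs_lt hp.out.pos
  have hx := abs_eq_abs_of_dvd_sq_sub hp.out lx lx' hg.dvd_x kg.dvd_x hg.parity_x kg.parity_x
  have e₁₂ : |bil h₁ h₂| = |bil k₁ k₂| := by rw [ex, ex']; exact_mod_cast hx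
  have e₃ : Nr h₃ = Nr k₃ :=
    le_antisymm (k.Nr_le₃ hO'.1 hc₁ hc₂ h hr' e₁.symm e₂.symm e₁₂.symm)
      (h.Nr_le₃ hO.1 hc₁ hc₂ k hr e₁ e₂ e₁₂)
  obtain rfl : C = C' := by rw [eC, eC'] at e₃; exact_mod_cast e₃
  have hy := abs_eq_abs_of_dvd_sq_sub hp.out ly ly' hg.dvd_y kg.dvd_y hg.parity_y kg.parity_y
  have hz := abs_eq_abs_of_dvd_sq_sub hp.out lz lz' hg.dvd_z kg.dvd_z hg.parity_z kg.parity_z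
  have hxyz : x * y * z = x' * y' * z' := by
    have d := hg.det.trans kg.det.symm
    rw [← sq_abs x, ← sq_abs y, ← sq_abs z, hx, hy, hz, sq_abs, sq_abs, sq_abs] at d
    linarith
  obtain ⟨a, b, ha, hb, c, hc, sx, sy, sz⟩ := exists_signs hx hy hz hxyz
  have re : ∀ {O : Subalgebra ℤ ℍ[ℚ, c₁, c₂]} {t : ℍ[ℚ, c₁, c₂]} (m : ℤ), t ∈ GrossLattice O →
      (m • t).re = 0 := fun m ht => re_of_mem_grossLattice (Submodule.smul_mem _ m ht)
  obtain ⟨C, D, ε, hCD, hDC, hε, f₁, f₂, f₃⟩ := exists_conj_of_gram_eq hc₁ hc₂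
    (re_of_mem_grossLattice h.mem₁) (re_of_mem_grossLattice h.mem₂) (re_of_mem_grossLattice h.mem₃)
    (re a k.mem₁) (re b k.mem₂) (re c k.mem₃) h.ne_zero₁ h.ne_smul₂
    (by rw [Nr_zsmul_sign ha, e₁]) (by rw [Nr_zsmul_sign hb, e₂]) (by rw [Nr_zsmul_sign hc, e₃])
    (by rw [bil_zsmul_zsmul, ex, ex', sx]; push_cast; rfl)
    (by rw [bil_zsmul_zsmul, ey, ey', sy]; push_cast; rfl)
    (by rw [bil_zsmul_zsmul, ez, ez', sz]; push_cast; rfl)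
  refine ⟨C, D, hCD, hDC, ?_⟩
  let F : ℍ[ℚ, c₁, c₂] →ₗ[ℤ] ℍ[ℚ, c₁, c₂] := (LinearMap.mulRight ℤ D).comp (LinearMap.mulLeft ℤ C)
  have hF : (GrossLattice O).map F = GrossLattice O' := by
    rw [h.eq_span, k.eq_span, Submodule.map_span, Set.image_insert_eq, Set.image_insert_eq,
      Set.image_singleton, ← span_smul_triple (h₁ := k₁) ha hb hc]
    change Submodule.span ℤ {C * h₁ * D, C * h₂ * D, C * h₃ * D} = _
    rw [f₁, f₂, f₃]
    rcases hε with rfl | rfl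
    · simp only [one_mul]
    · have e : (-1 : ℤ) = 1 ∨ (-1 : ℤ) = -1 := Or.inr rfl
      rw [← span_smul_triple e e e]
      simp only [neg_one_mul, neg_smul, one_smul, neg_neg]
  rw [← hF, Submodule.map_coe]
  rfl

theorem exists_isometry_of_conj {O O' : Subalgebra ℤ ℍ[ℚ, c₁, c₂]} {c d : ℍ[ℚ, c₁, c₂]}
    (hcd : c * d = 1) (hdc : d * c = 1)
    (h : (fun x => c * x * d) '' (GrossLattice O : Set ℍ[ℚ, c₁, c₂]) =
      (GrossLattice O' : Set ℍ[ℚ, c₁, c₂])) :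
    ∃ φ : GrossLattice O ≃ₗ[ℤ] GrossLattice O',
      ∀ h : GrossLattice O, Nr (φ h : ℍ[ℚ, c₁, c₂]) = Nr (h : ℍ[ℚ, c₁, c₂]) := by
  let F : ℍ[ℚ, c₁, c₂] →ₗ[ℤ] ℍ[ℚ, c₁, c₂] := (LinearMap.mulRight ℤ d).comp (LinearMap.mulLeft ℤ c)
  have hinj : Function.Injective F := by
    have f : ∀ x, d * F x * c = x := fun x => by
      change d * (c * x * d) * c = x
      rw [mul_assoc, mul_assoc (c * x), hdc, mul_one, ← mul_assoc, hdc, one_mul]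
    intro x y e
    rw [← f x, e, f y]
  have hF : (GrossLattice O).map F = GrossLattice O' := SetLike.coe_injective h
  refine ⟨(Submodule.equivMapOfInjective F hinj _).trans (LinearEquiv.ofEq _ _ hF), fun x => ?_⟩
  exact Nr_conj hcd _

theorem rCount_eq_of_isometry {O O' : Subalgebra ℤ ℍ[ℚ, c₁, c₂]}
    (φ : GrossLattice O ≃ₗ[ℤ] GrossLattice O')
    (hφ : ∀ h : GrossLattice O, Nr (φ h : ℍ[ℚ, c₁, c₂]) = Nr (h : ℍ[ℚ, c₁, c₂])) (n : ℕ) :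
    rCount O n = rCount O' n := by
  refine Nat.card_congr
    { toFun := fun h => ⟨φ ⟨h.1, h.2.1⟩, (φ ⟨h.1, h.2.1⟩).2, (hφ _).trans h.2.2⟩
      invFun := fun h => ⟨φ.symm ⟨h.1, h.2.1⟩, (φ.symm ⟨h.1, h.2.1⟩).2, ?_⟩
      left_inv := fun h => by simp
      right_inv := fun h => by simp }
  rw [← hφ, φ.apply_symm_apply]
  exact h.2.2

/-- for maximal orders `O`, `O'` of a quaternion algebra ramified exactly
at `p` and `∞`, the following are equivalent: (a) the Gross lattices are conjugate in `B`;
(b) the theta series of the Gross lattices agree; (c) the associated ternary quadratic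
forms are ℤ-equivalent. -/
theorem grossLattice_tfae
    (p : ℕ) [Fact p.Prime] (c₁ c₂ : ℚ) (hc₁ : c₁ ≠ 0) (hc₂ : c₂ ≠ 0)
    (hram : RamifiedExactlyAt p c₁ c₂)
    (O O' : Subalgebra ℤ ℍ[ℚ, c₁, c₂])
    (hO : IsMaximalOrder O) (hO' : IsMaximalOrder O') :
    List.TFAE
      [ ∃ c d : ℍ[ℚ, c₁, c₂], c * d = 1 ∧ d * c = 1 ∧
          (fun x => c * x * d) '' (GrossLattice O : Set ℍ[ℚ, c₁, c₂])
            = (GrossLattice O' : Set ℍ[ℚ, c₁, c₂]),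
        ∀ n : ℕ, 1 ≤ n → rCount O n = rCount O' n,
        ∃ φ : GrossLattice O ≃ₗ[ℤ] GrossLattice O',
          ∀ h : GrossLattice O, Nr (φ h : ℍ[ℚ, c₁, c₂]) = Nr (h : ℍ[ℚ, c₁, c₂]) ] := by
  tfae_have 1 → 3
  | ⟨c, d, hcd, hdc, h⟩ => exists_isometry_of_conj hcd hdc h
  tfae_have 3 → 2
  | ⟨φ, hφ⟩, n, _ => rCount_eq_of_isometry φ hφ n
  tfae_have 2 → 1 := exists_conj_of_rCount_eq hram hO hO'
  tfae_finish
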